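/- Let 𝒢 be a minor-closed class of finite graphs, and let t, m ≥ 1 be integers such that K_{t,m} ∉ 𝒢 and I_{t-1}+P_m ∉ 𝒢. Then there exists an integer C ≥ 1 such that every graph in 𝒢 admits a 2t-coloring with clustering C. -/

import Mathlib

open SimpleGraph

/-- `S` is a `t`-island in `G`: a nonempty set of vertices each of which has
fewer than `t` neighbors outside `S`. -/
def IsIsland {V : Type*} (G : SimpleGraph V) (t : ℕ) (S : Set V) : Prop :=
  S.Nonempty ∧ ∀ v ∈ S, ((G.neighborSet v) \ S).ncard < t

/-- `H` is a minor of `G`: there is a model of `H` in `G`. -/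
def IsMinorOf {W V : Type*} (H : SimpleGraph W) (G : SimpleGraph V) : Prop :=
  ∃ μ : W → Set V,
    (∀ w, (μ w).Nonempty) ∧
    (∀ w, (G.induce (μ w)).Connected) ∧
    (Pairwise fun w₁ w₂ => Disjoint (μ w₁) (μ w₂)) ∧
    (∀ ⦃w₁ w₂⦄, H.Adj w₁ w₂ → ∃ u ∈ μ w₁, ∃ v ∈ μ w₂, G.Adj u v)

/-- The graph `I_n + P_m`: a path on `m` vertices together with `n` additional
pairwise non-adjacent vertices, each adjacent to every vertex of the path. -/
def IplusP (n m : ℕ) : SimpleGraph (Fin n ⊕ Fin m) :=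
  SimpleGraph.fromRel (fun a b =>
    (∃ i j, a = Sum.inl i ∧ b = Sum.inr j) ∨
    (∃ i j : Fin m, a = Sum.inr i ∧ b = Sum.inr j ∧ (i : ℕ) + 1 = (j : ℕ)))

/-- `c` is a coloring of `G` with clustering `C`: every monochromatic connected
subgraph has at most `C` vertices. -/
def ClusteredColoring {V α : Type*} (G : SimpleGraph V) (C : ℕ) (c : V → α) : Prop :=
  ∀ S : Set V, (G.induce S).Connected → (∀ u ∈ S, ∀ v ∈ S, c u = c v) → S.ncard ≤ C

/-- `G` has a tree decomposition of width at most `w`. -/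
def HasTreewidthAtMost {V : Type*} (G : SimpleGraph V) (w : ℕ) : Prop :=
  ∃ (n : ℕ) (T : SimpleGraph (Fin n)) (β : Fin n → Set V), T.IsTree ∧
    (∀ ⦃u v⦄, G.Adj u v → ∃ x, u ∈ β x ∧ v ∈ β x) ∧
    (∀ v : V, (T.induce {x | v ∈ β x}).Connected) ∧
    (∀ x, (β x).ncard ≤ w + 1)

/-- A class of graphs, given for each `n` as a collection of graphs on `Fin n`. -/
def MemClass (𝒢 : ∀ n : ℕ, SimpleGraph (Fin n) → Prop) {V : Type*} (G : SimpleGraph V) : Prop :=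
  ∃ (n : ℕ) (G' : SimpleGraph (Fin n)), 𝒢 n G' ∧ Nonempty (G ≃g G')

/-- `𝒢` is a (proper) minor-closed class. -/
def MinorClosed (𝒢 : ∀ n : ℕ, SimpleGraph (Fin n) → Prop) : Prop :=
  (∃ (n : ℕ) (G : SimpleGraph (Fin n)), ¬ 𝒢 n G) ∧
  ∀ ⦃n k : ℕ⦄ (G : SimpleGraph (Fin n)) (H : SimpleGraph (Fin k)),
    𝒢 n G → IsMinorOf H G → 𝒢 k H

/-- `𝒢` is closed under taking subgraphs (up to isomorphism). -/
def SubgraphClosed (𝒢 : ∀ n : ℕ, SimpleGraph (Fin n) → Prop) : Prop :=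
  ∀ ⦃n k : ℕ⦄ (G : SimpleGraph (Fin n)) (H : SimpleGraph (Fin k)), 𝒢 n G →
    (∃ f : Fin k → Fin n, Function.Injective f ∧ ∀ ⦃a b⦄, H.Adj a b → G.Adj (f a) (f b)) →
    𝒢 k H

/-- The vertices that eventually become active in bootstrap `t`-percolation
starting from the active set `A`. -/
inductive PercolationActive {V : Type*} (G : SimpleGraph V) (t : ℕ) (A : Set V) : V → Prop
  | base (v : V) : v ∈ A → PercolationActive G t A v
  | step (v : V) (N : Finset V) : t ≤ N.card → (∀ u ∈ N, G.Adj v u) →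
      (∀ u ∈ N, PercolationActive G t A u) → PercolationActive G t A v

/-- The set `A` `t`-percolates in `G`. -/
def Percolates {V : Type*} (G : SimpleGraph V) (t : ℕ) (A : Set V) : Prop :=
  ∀ v, PercolationActive G t A v

/-- `G` contains `k` pairwise disjoint `t`-islands. -/
def HasDisjointIslands {V : Type*} (G : SimpleGraph V) (t k : ℕ) : Prop :=
  ∃ f : Fin k → Set V, (∀ i, IsIsland G t (f i)) ∧ Pairwise (Function.onFun Disjoint f)

/-- `f` is significantly sublinear: `∑ f(⌈(3/2)^i⌉)/(3/2)^i` is finite. -/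
def SignificantlySublinear (f : ℕ → ℕ) : Prop :=
  Summable (fun i : ℕ => (f ⌈((3:ℝ)/2)^i⌉₊ : ℝ) / ((3:ℝ)/2)^i)

/-- The class `𝒢` has `f`-separators. -/
def HasSeparators (f : ℕ → ℕ) (𝒢 : ∀ n : ℕ, SimpleGraph (Fin n) → Prop) : Prop :=
  ∀ (n : ℕ) (G : SimpleGraph (Fin n)), 𝒢 n G →
    ∃ L R : G.Subgraph, L ⊔ R = ⊤ ∧ (L.verts ∩ R.verts).ncard ≤ f n ∧
      3 * (L.verts \ R.verts).ncard ≤ 2 * n ∧ 3 * (R.verts \ L.verts).ncard ≤ 2 * n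

/-- The number of edges of `G` with at least one end in `A`. -/
noncomputable def edgesTouching {V : Type*} (G : SimpleGraph V) (A : Set V) : ℕ :=
  {e ∈ G.edgeSet | ∃ v ∈ A, v ∈ e}.ncard

section Minors

variable {U V W : Type*}

/-- One step of a walk in `G` that stays in `S`. -/
def StepIn (G : SimpleGraph V) (S : Set V) (a b : V) : Prop := a ∈ S ∧ b ∈ S ∧ G.Adj a b

theorem StepIn.mono {G H : SimpleGraph V} {S T : Set V} (hG : G ≤ H) (hS : S ⊆ T) {a b : V}
    (h : StepIn G S a b) : StepIn H T a b :=
  ⟨hS h.1, hS h.2.1, hG h.2.2⟩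

theorem reflTransGen_stepIn_of_connected {G : SimpleGraph V} {S : Set V}
    (h : (G.induce S).Connected) {a b : V} (ha : a ∈ S) (hb : b ∈ S) :
    Relation.ReflTransGen (StepIn G S) a b := by
  have h1 := (SimpleGraph.reachable_iff_reflTransGen _ _).1 (h.preconnected ⟨a, ha⟩ ⟨b, hb⟩)
  exact h1.lift Subtype.val fun x y hxy => ⟨x.2, y.2, hxy⟩

theorem connected_induce_of_center {G : SimpleGraph V} {S : Set V} {c : V} (hc : c ∈ S)
    (h : ∀ v ∈ S, Relation.ReflTransGen (StepIn G S) c v) : (G.induce S).Connected := by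
  have key : ∀ v, Relation.ReflTransGen (StepIn G S) c v → ∀ hv : v ∈ S,
      (G.induce S).Reachable ⟨c, hc⟩ ⟨v, hv⟩ := by
    intro v hv
    induction hv with
    | refl => intro _; exact .refl _
    | tail _ h ih =>
      intro hv
      exact (ih h.1).trans (SimpleGraph.Adj.reachable (G := G.induce S) h.2.2)
  have : Nonempty S := ⟨⟨c, hc⟩⟩
  exact ⟨fun u v => (key u (h u u.2) u.2).symm.trans (key v (h v v.2) v.2)⟩

theorem connected_induce_singleton (G : SimpleGraph V) (v : V) :
    (G.induce ({v} : Set V)).Connected :=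
  connected_induce_of_center rfl fun u hu => by
    rw [Set.mem_singleton_iff.1 hu]

theorem connected_induce_mono {G H : SimpleGraph V} (hGH : G ≤ H) {S : Set V}
    (h : (G.induce S).Connected) : (H.induce S).Connected :=
  h.mono fun _ _ hab => hGH hab

theorem connected_induce_union {G : SimpleGraph V} {S T : Set V} (hS : (G.induce S).Connected)
    (hT : (G.induce T).Connected) {a b : V} (ha : a ∈ S) (hb : b ∈ T) (hab : a = b ∨ G.Adj a b) :
    (G.induce (S ∪ T)).Connected := by
  refine connected_induce_of_center (c := a) (.inl ha) ?_
  have hl : ∀ v ∈ S, Relation.ReflTransGen (StepIn G (S ∪ T)) a v := fun v hv =>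
    (reflTransGen_stepIn_of_connected hS ha hv).lift id
      fun _ _ h => h.mono le_rfl Set.subset_union_left
  rintro v (hv | hv)
  · exact hl v hv
  · have h2 : Relation.ReflTransGen (StepIn G (S ∪ T)) b v :=
      (reflTransGen_stepIn_of_connected hT hb hv).lift id
        fun _ _ h => h.mono le_rfl Set.subset_union_right
    rcases hab with rfl | hab
    · exact h2
    · exact .head ⟨.inl ha, .inr hb, hab⟩ h2

theorem IsMinorOf.trans {H : SimpleGraph U} {Q : SimpleGraph W} {G : SimpleGraph V}
    (hHQ : IsMinorOf H Q) (hQG : IsMinorOf Q G) : IsMinorOf H G := by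
  obtain ⟨μ, μn, μc, μd, μa⟩ := hHQ
  obtain ⟨ν, νn, νc, νd, νa⟩ := hQG
  refine ⟨fun h => ⋃ q ∈ μ h, ν q, fun h => ?_, fun h => ?_, fun h₁ h₂ hne => ?_, ?_⟩
  · obtain ⟨q, hq⟩ := μn h
    obtain ⟨x, hx⟩ := νn q
    exact ⟨x, Set.mem_biUnion hq hx⟩
  · obtain ⟨q, hq⟩ := μn h
    obtain ⟨x, hx⟩ := νn q
    have hin : ∀ q ∈ μ h, ∀ a ∈ ν q, ∀ b ∈ ν q,
        Relation.ReflTransGen (StepIn G (⋃ q ∈ μ h, ν q)) a b := fun q hq a ha b hb =>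
      (reflTransGen_stepIn_of_connected (νc q) ha hb).lift id
        fun _ _ h => h.mono le_rfl (Set.subset_biUnion_of_mem (u := ν) hq)
    have key : ∀ p, Relation.ReflTransGen (StepIn Q (μ h)) q p → p ∈ μ h → ∀ y ∈ ν p,
        Relation.ReflTransGen (StepIn G (⋃ q ∈ μ h, ν q)) x y := by
      intro p hp
      induction hp with
      | refl => intro _ y hy; exact hin q hq x hx y hy
      | tail _ hs ih =>
        intro hp y hy
        obtain ⟨u, hu, v, hv, huv⟩ := νa hs.2.2
        exact ((ih hs.1 u hu).tail ⟨Set.mem_biUnion hs.1 hu, Set.mem_biUnion hp hv, huv⟩).trans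
          (hin _ hp v hv y hy)
    refine connected_induce_of_center (Set.mem_biUnion hq hx) fun y hy => ?_
    obtain ⟨p, hp, hy⟩ := Set.mem_iUnion₂.1 hy
    exact key p (reflTransGen_stepIn_of_connected (μc h) hq hp) hp y hy
  · refine Set.disjoint_left.2 fun x hx₁ hx₂ => ?_
    obtain ⟨p, hp, hxp⟩ := Set.mem_iUnion₂.1 hx₁
    obtain ⟨q, hq, hxq⟩ := Set.mem_iUnion₂.1 hx₂
    have hpq : p = q := by
      by_contra hpq
      exact Set.disjoint_left.1 (νd hpq) hxp hxq
    subst hpq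
    exact Set.disjoint_left.1 (μd hne) hp hq
  · intro h₁ h₂ hadj
    obtain ⟨p, hp, q, hq, hpq⟩ := μa hadj
    obtain ⟨u, hu, v, hv, huv⟩ := νa hpq
    exact ⟨u, Set.mem_biUnion hp hu, v, Set.mem_biUnion hq hv, huv⟩

theorem isMinorOf_of_injective {H : SimpleGraph W} {G : SimpleGraph V} (f : W → V)
    (hf : Function.Injective f) (h : ∀ ⦃a b⦄, H.Adj a b → G.Adj (f a) (f b)) : IsMinorOf H G :=
  ⟨fun w => {f w}, fun _ => ⟨_, rfl⟩, fun _ => connected_induce_singleton G _,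
    fun _ _ hne => Set.disjoint_singleton.2 (hf.ne hne), fun _ _ hab => ⟨_, rfl, _, rfl, h hab⟩⟩

theorem IsMinorOf.mono_right {H : SimpleGraph W} {G G' : SimpleGraph V} (hG : G ≤ G')
    (h : IsMinorOf H G) : IsMinorOf H G' :=
  h.trans (isMinorOf_of_injective id Function.injective_id fun _ _ hab => hG hab)

theorem isMinorOf_completeBipartiteGraph {G : SimpleGraph V} {t m : ℕ} (T : Fin t → Set V)
    (S : Fin m → Set V) (hT : ∀ j, (G.induce (T j)).Connected)
    (hS : ∀ i, (G.induce (S i)).Connected) (hTT : Pairwise fun i j => Disjoint (T i) (T j))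
    (hSS : Pairwise fun i j => Disjoint (S i) (S j)) (hST : ∀ i j, Disjoint (S i) (T j))
    (hadj : ∀ i j, ∃ u ∈ S i, ∃ v ∈ T j, G.Adj u v) :
    IsMinorOf (completeBipartiteGraph (Fin t) (Fin m)) G := by
  refine ⟨Sum.elim T S, ?_, ?_, ?_, ?_⟩
  · rintro (j | i)
    · exact Set.nonempty_coe_sort.1 (hT j).nonempty
    · exact Set.nonempty_coe_sort.1 (hS i).nonempty
  · rintro (j | i)
    · exact hT j
    · exact hS i
  · rintro (j | i) (j' | i') hne
    · exact hTT fun h => hne (by rw [h])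
    · exact (hST i' j).symm
    · exact hST i j'
    · exact hSS fun h => hne (by rw [h])
  · rintro (j | i) (j' | i') hab
    · simp at hab
    · obtain ⟨u, hu, v, hv, huv⟩ := hadj i' j
      exact ⟨v, hv, u, hu, huv.symm⟩
    · exact hadj i j'
    · simp at hab

end Minors

section Density

open Classical in
/-- The number of neighbors of `v` in the finite set `A`. -/
noncomputable def degIn {V : Type*} (G : SimpleGraph V) (A : Finset V) (v : V) : ℕ :=
  (A.filter (G.Adj v)).card

/-- Twice the number of edges of `G` spanned by `A`. -/
noncomputable def degSum {V : Type*} (G : SimpleGraph V) (A : Finset V) : ℕ :=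
  ∑ v ∈ A, degIn G A v

variable {V : Type*}

open Classical in
theorem degSum_insert (G : SimpleGraph V) {A : Finset V} {v : V} (hv : v ∉ A) :
    degSum G (insert v A) = degSum G A + 2 * degIn G A v := by
  have h1 : degIn G (insert v A) v = degIn G A v := by
    simp [degIn, Finset.filter_insert]
  have h2 : ∀ u ∈ A, degIn G (insert v A) u = degIn G A u + if G.Adj v u then 1 else 0 := by
    intro u hu
    by_cases h : G.Adj v u
    · simp [degIn, Finset.filter_insert, h, h.symm, hv]
    · have : ¬ G.Adj u v := fun h' => h h'.symm
      simp [degIn, Finset.filter_insert, h, this]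
  rw [degSum, Finset.sum_insert hv, h1, Finset.sum_congr rfl h2, Finset.sum_add_distrib,
    Finset.sum_boole]
  simp [degSum, degIn]
  ring

open Classical in
theorem exists_clique_model (G : SimpleGraph V) (h : ℕ) :
    ∀ A : Finset V, A.Nonempty → 2 ^ (h + 1) * A.card ≤ degSum G A →
      ∃ μ : Fin h → Set V, (∀ i, μ i ⊆ A) ∧ (∀ i, (G.induce (μ i)).Connected) ∧
        (Pairwise fun i j => Disjoint (μ i) (μ j)) ∧
        ∀ i j, i ≠ j → ∃ u ∈ μ i, ∃ v ∈ μ j, G.Adj u v := by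
  induction h with
  | zero =>
    intro A _ _
    exact ⟨fun _ => ∅, fun i => i.elim0, fun i => i.elim0, fun i => i.elim0, fun i => i.elim0⟩
  | succ h ih =>
    intro A
    induction A using Finset.strongInduction with
    | H A ihA =>
    intro hA hdens
    set N : Finset V → Finset V := fun X => (A \ X).filter fun v => ∃ u ∈ X, G.Adj u v with hN
    set P : Finset V → Prop := fun X => X ⊆ A ∧ (G.induce (X : Set V)).Connected ∧
      2 ^ (h + 2) * ((A \ X).card + 1) ≤ degSum G (A \ X) + 2 * (N X).card with hP
    have hex : ∃ X, P X := by
      obtain ⟨v, hv⟩ := hA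
      refine ⟨{v}, by simpa using hv, by
        rw [Finset.coe_singleton]; exact connected_induce_singleton G v, ?_⟩
      have hv' : v ∉ A \ {v} := by simp
      have hins : insert v (A \ {v}) = A := by
        ext x; by_cases hx : x = v <;> simp [hx, hv]
      have h1 := degSum_insert G hv'
      have h2 := Finset.card_insert_of_notMem hv'
      rw [hins] at h1 h2
      have h3 : (N {v}).card = degIn G (A \ {v}) v := by simp [hN, degIn]
      rw [h3, ← h2, ← h1]
      exact hdens
    obtain ⟨X, hX, hmax⟩ : ∃ X, P X ∧ ∀ Y, P Y → Y.card ≤ X.card := by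
      have hfin : {X | P X}.Finite := (A.powerset.finite_toSet).subset fun X hX => by
        simpa using hX.1
      obtain ⟨X, hX, hX'⟩ := Set.exists_max_image _ Finset.card hfin hex
      exact ⟨X, hX, hX'⟩
    obtain ⟨hXA, hXc, hXd⟩ := hX
    obtain ⟨x₀, hx₀⟩ : X.Nonempty := by
      simpa using Set.nonempty_coe_sort.1 hXc.nonempty
    by_cases hNe : (N X).Nonempty
    · have hdeg : ∀ v ∈ N X, 2 ^ (h + 1) ≤ degIn G (N X) v := by
        intro v hv
        obtain ⟨hvX, u, hu, huv⟩ := Finset.mem_filter.1 hv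
        obtain ⟨hvA, hvX⟩ := Finset.mem_sdiff.1 hvX
        have hnot : ¬ P (insert v X) := fun hP => by
          have := hmax _ hP
          rw [Finset.card_insert_of_notMem hvX] at this
          omega
        have hconn : (G.induce ((insert v X : Finset V) : Set V)).Connected := by
          have := connected_induce_union hXc (connected_induce_singleton G v) hu rfl (.inr huv)
          rwa [Finset.coe_insert, Set.insert_eq, Set.union_comm]
        have hsub : insert v X ⊆ A := Finset.insert_subset hvA hXA
        have hlt : degSum G (A \ insert v X) + 2 * (N (insert v X)).card <
            2 ^ (h + 2) * ((A \ insert v X).card + 1) := by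
          by_contra hle
          exact hnot ⟨hsub, hconn, not_lt.1 hle⟩
        have hv' : v ∉ A \ insert v X := by simp
        have hins : insert v (A \ insert v X) = A \ X := by
          ext x; by_cases hx : x = v <;> simp [hx, hvA, hvX]
        have h1 := degSum_insert G hv'
        have h2 := Finset.card_insert_of_notMem hv'
        rw [hins] at h1 h2
        have h3 : degIn G (A \ insert v X) v ≤ degIn G (N X) v +
            (((A \ insert v X).filter (G.Adj v)) \ N X).card := by
          rw [degIn, degIn, ← Finset.card_inter_add_card_sdiff _ (N X)]
          gcongr
          intro x hx
          simp only [Finset.mem_inter, Finset.mem_filter] at hx ⊢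
          exact ⟨hx.2, hx.1.2⟩
        have h4 : (N X).card - 1 + (((A \ insert v X).filter (G.Adj v)) \ N X).card ≤
            (N (insert v X)).card := by
          rw [← Finset.card_erase_of_mem hv, ← Finset.card_union_of_disjoint]
          · apply Finset.card_le_card
            intro x hx
            simp only [hN, Finset.mem_union, Finset.mem_erase, Finset.mem_sdiff,
              Finset.mem_filter, Finset.mem_insert] at hx ⊢
            rcases hx with ⟨h5, h6, y, h7, h8⟩ | ⟨⟨h5, h6⟩, _⟩
            · exact ⟨⟨h6.1, by tauto⟩, y, .inr h7, h8⟩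
            · exact ⟨h5, v, .inl rfl, h6⟩
          · refine Finset.disjoint_left.2 fun x hx hx' => ?_
            exact (Finset.mem_sdiff.1 hx').2 (Finset.mem_of_mem_erase hx)
        have h5 : 0 < (N X).card := Finset.card_pos.2 hNe
        rw [h2, h1] at hXd
        simp only [mul_add, mul_one] at hXd hlt
        have h6 : 2 ^ (h + 2) = 2 * 2 ^ (h + 1) := by ring
        by_contra hlt'
        omega
      have hdN : 2 ^ (h + 1) * (N X).card ≤ degSum G (N X) := by
        rw [degSum, mul_comm, ← smul_eq_mul, ← Finset.sum_const]
        exact Finset.sum_le_sum hdeg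
      obtain ⟨μ, hμA, hμc, hμd, hμa⟩ := ih _ hNe hdN
      have hμX : ∀ i, Disjoint (X : Set V) (μ i) := fun i =>
        Set.disjoint_left.2 fun x hx hx' =>
          (Finset.mem_sdiff.1 (Finset.mem_filter.1 (hμA i hx')).1).2 hx
      have hXμ : ∀ i, ∃ u ∈ (X : Set V), ∃ v ∈ μ i, G.Adj u v := by
        intro i
        obtain ⟨v, hv⟩ := Set.nonempty_coe_sort.1 (hμc i).nonempty
        obtain ⟨u, hu, huv⟩ := (Finset.mem_filter.1 (hμA i hv)).2
        exact ⟨u, hu, v, hv, huv⟩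
      refine ⟨Fin.cons (X : Set V) μ, ?_, ?_, ?_, ?_⟩
      · refine Fin.cases (by simpa using hXA) fun i => ?_
        simp only [Fin.cons_succ]
        exact fun x hx => (Finset.mem_sdiff.1 (Finset.mem_filter.1 (hμA i hx)).1).1
      · refine Fin.cases hXc fun i => hμc i
      · intro i j
        refine Fin.cases ?_ (fun i => ?_) i <;> refine Fin.cases ?_ (fun j => ?_) j
        · simp
        · intro _; simpa using hμX j
        · intro _; simpa using (hμX i).symm
        · intro hij; simpa using hμd fun h => hij (by rw [h])
      · intro i j
        refine Fin.cases ?_ (fun i => ?_) i <;> refine Fin.cases ?_ (fun j => ?_) j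
        · simp
        · intro _; simpa using hXμ j
        · intro _
          obtain ⟨u, hu, v, hv, huv⟩ := hXμ i
          exact ⟨v, by simpa using hv, u, by simpa using hu, huv.symm⟩
        · intro hij; simpa using hμa i j fun h => hij (by rw [h])
    · rw [Finset.not_nonempty_iff_eq_empty.1 hNe, Finset.card_empty, mul_zero, add_zero] at hXd
      have hpos : 0 < 2 ^ (h + 2) := by positivity
      have hne : (A \ X).Nonempty := by
        by_contra hemp
        rw [Finset.not_nonempty_iff_eq_empty.1 hemp] at hXd
        simp [degSum] at hXd
      have hss : A \ X ⊂ A := by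
        refine ⟨Finset.sdiff_subset, fun hle => ?_⟩
        exact (Finset.mem_sdiff.1 (hle (hXA hx₀))).2 hx₀
      obtain ⟨μ, hμA, hμ⟩ := ihA _ hss hne (le_trans (by gcongr; omega) hXd)
      exact ⟨μ, fun i => (hμA i).trans (by simp), hμ⟩

theorem degSum_lt_of_not_isMinorOf {G : SimpleGraph V} {t m : ℕ}
    (hG : ¬ IsMinorOf (completeBipartiteGraph (Fin t) (Fin m)) G) {A : Finset V}
    (hA : A.Nonempty) : degSum G A < 2 ^ (t + m + 1) * A.card := by
  by_contra hle
  obtain ⟨μ, -, hc, hd, ha⟩ := exists_clique_model G (t + m) A hA (not_lt.1 hle)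
  have hne : ∀ (i : Fin m) (j : Fin t), Fin.natAdd t i ≠ Fin.castAdd m j := fun i j h => by
    have := congrArg Fin.val h
    simp at this
    omega
  refine hG (isMinorOf_completeBipartiteGraph (fun j => μ (Fin.castAdd m j))
    (fun i => μ (Fin.natAdd t i)) (fun _ => hc _) (fun _ => hc _) ?_ ?_ ?_ ?_)
  · exact fun i j hij => hd fun h => hij (Fin.castAdd_injective _ _ h)
  · exact fun i j hij => hd fun h => hij (by simpa using h)
  · exact fun i j => hd (hne i j)
  · exact fun i j => ha _ _ (hne i j)

end Density

section LightEdge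

variable {V W ι : Type*}

open Classical in
theorem degIn_mono_right {G H : SimpleGraph V} (hGH : G ≤ H) (A : Finset V) (v : V) :
    degIn G A v ≤ degIn H A v :=
  Finset.card_le_card fun u hu => by
    rw [Finset.mem_filter] at hu ⊢
    exact ⟨hu.1, hGH hu.2⟩

theorem exists_degIn_le_of_not_isMinorOf {G : SimpleGraph V} {t m : ℕ}
    (hG : ¬ IsMinorOf (completeBipartiteGraph (Fin t) (Fin m)) G) {A : Finset V}
    (hA : A.Nonempty) : ∃ v ∈ A, degIn G A v ≤ 2 ^ (t + m + 1) := by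
  by_contra! h
  refine (degSum_lt_of_not_isMinorOf hG hA).not_ge ?_
  rw [degSum, mul_comm, ← smul_eq_mul, ← Finset.sum_const]
  exact Finset.sum_le_sum fun v hv => (h v hv).le

open Classical in
/-- In a `d`-degenerate graph there are few cliques, hence few indices labelling them if every
clique is used a bounded number of times. -/
theorem card_le_of_cliques (Q : SimpleGraph W) {d m t : ℕ} (ht : 1 ≤ t)
    (hQ : ∀ A : Finset W, A.Nonempty → ∃ v ∈ A, degIn Q A v ≤ d) (f : ι → Finset W)
    (B : Finset W) : ∀ I : Finset ι, (∀ i ∈ I, f i ⊆ B ∧ (f i).card = t ∧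
        ∀ u ∈ f i, ∀ v ∈ f i, u ≠ v → Q.Adj u v) →
      (∀ K : Finset W, ∀ J ⊆ I, (∀ i ∈ J, f i = K) → J.card ≤ m) →
      I.card ≤ m * 2 ^ (d + 1) * B.card := by
  induction B using Finset.strongInduction with
  | H B ih =>
  intro I hI hm
  rcases B.eq_empty_or_nonempty with rfl | hB
  · rcases I.eq_empty_or_nonempty with rfl | ⟨i, hi⟩
    · simp
    · obtain ⟨h1, h2, -⟩ := hI i hi
      rw [Finset.subset_empty.1 h1, Finset.card_empty] at h2
      omega
  obtain ⟨v, hvB, hv⟩ := hQ B hB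
  have h1 : (I.filter fun i => v ∈ f i).card ≤ m * 2 ^ (d + 1) := by
    have himg : ((I.filter fun i => v ∈ f i).image f) ⊆
        (insert v (B.filter (Q.Adj v))).powerset := by
      intro K hK
      obtain ⟨i, hi, rfl⟩ := Finset.mem_image.1 hK
      obtain ⟨hi, hvi⟩ := Finset.mem_filter.1 hi
      obtain ⟨h1, -, h3⟩ := hI i hi
      refine Finset.mem_powerset.2 fun u hu => ?_
      by_cases huv : u = v
      · simp [huv]
      · simp [huv, h1 hu, h3 v hvi u hu (Ne.symm huv)]
    calc _ ≤ m * ((I.filter fun i => v ∈ f i).image f).card := by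
          refine Finset.card_le_mul_card_image _ m fun K _ => ?_
          exact hm K _ ((Finset.filter_subset _ _).trans (Finset.filter_subset _ _))
            fun i hi => (Finset.mem_filter.1 hi).2
      _ ≤ m * 2 ^ (d + 1) := by
          gcongr
          refine (Finset.card_le_card himg).trans ?_
          rw [Finset.card_powerset]
          refine Nat.pow_le_pow_right (by norm_num) ((Finset.card_insert_le _ _).trans ?_)
          exact Nat.succ_le_succ hv
  have h2 : (I.filter fun i => v ∉ f i).card ≤ m * 2 ^ (d + 1) * (B.erase v).card := by
    refine ih _ (Finset.erase_ssubset hvB) _ (fun i hi => ?_)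
      fun K J hJ => hm K J (hJ.trans (Finset.filter_subset _ _))
    · obtain ⟨hi, hvi⟩ := Finset.mem_filter.1 hi
      obtain ⟨h1, h2⟩ := hI i hi
      exact ⟨fun u hu => Finset.mem_erase.2 ⟨fun h => hvi (h ▸ hu), h1 hu⟩, h2⟩
  rw [← Finset.card_filter_add_card_filter_not (s := I) (fun i => v ∈ f i),
    ← Finset.card_erase_add_one hvB]
  linarith

theorem isMinorOf_of_forall_adj {G : SimpleGraph V} {t m : ℕ} {K I : Finset V}
    (hK : K.card = t) (hI : I.card = m) (hKI : ∀ u ∈ K, ∀ v ∈ I, G.Adj u v) :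
    IsMinorOf (completeBipartiteGraph (Fin t) (Fin m)) G := by
  let e := (K.equivFinOfCardEq hK).symm
  let e' := (I.equivFinOfCardEq hI).symm
  have hadj : ∀ i j, G.Adj (e i) (e' j) := fun i j => hKI _ (e i).2 _ (e' j).2
  refine isMinorOf_of_injective (Sum.elim (fun i => (e i : V)) fun j => (e' j : V)) ?_ ?_
  · rintro (i | i) (j | j) hij
    · simpa [Subtype.val_inj] using hij
    · exact ((hadj i j).ne hij).elim
    · exact ((hadj j i).ne hij.symm).elim
    · simpa [Subtype.val_inj] using hij
  · rintro (i | i) (j | j) hij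
    · simp at hij
    · exact hadj i j
    · exact (hadj j i).symm
    · simp at hij

open Classical in
theorem card_le_of_not_isMinorOf {G : SimpleGraph V} {t m : ℕ} (ht : 1 ≤ t)
    (hG : ¬ IsMinorOf (completeBipartiteGraph (Fin t) (Fin m)) G) (A B : Finset V)
    (hAB : Disjoint A B) (hA : ∀ a ∈ A, t ≤ degIn G B a) :
    A.card ≤ (2 ^ (t + m + 1) + m * 2 ^ (2 ^ (t + m + 1) + 1)) * B.card := by
  set P : Finset V → (V → V × V) → Prop := fun X g => X ⊆ A ∧
    (∀ a ∈ X, (g a).1 ∈ B ∧ (g a).2 ∈ B ∧ G.Adj a (g a).1 ∧ G.Adj a (g a).2 ∧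
      (g a).1 ≠ (g a).2) ∧ Set.InjOn g X with hP
  obtain ⟨X, ⟨g, hXA, hg, hinj⟩, hmax⟩ : ∃ X, (∃ g, P X g) ∧ ∀ Y, (∃ g, P Y g) →
      Y.card ≤ X.card := by
    have hfin : {X | ∃ g, P X g}.Finite := (A.powerset.finite_toSet).subset fun X hX => by
      obtain ⟨g, hX, -⟩ := hX
      simpa using hX
    obtain ⟨X, hX, hX'⟩ := Set.exists_max_image _ Finset.card hfin
      ⟨∅, fun a => (a, a), by simp [hP]⟩
    exact ⟨X, hX, hX'⟩
  let Q : SimpleGraph B :=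
    { Adj := fun u v => G.Adj u v ∨ ∃ a ∈ X, g a = (u.1, v.1) ∨ g a = (v.1, u.1)
      symm := ⟨fun u v h => by
        rcases h with h | ⟨a, ha, h⟩
        · exact .inl h.symm
        · exact .inr ⟨a, ha, h.symm⟩⟩
      loopless := ⟨fun u h => by
        rcases h with h | ⟨a, ha, h⟩
        · exact h.ne rfl
        · have := (hg a ha).2.2.2.2
          rw [or_self] at h
          rw [h] at this
          exact this rfl⟩ }
  have hQG : IsMinorOf Q G := by
    refine ⟨fun b => insert b.1 {a | a ∈ X ∧ (g a).1 = b}, fun b => ⟨b, .inl rfl⟩, fun b => ?_,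
      fun b b' hne => ?_, fun u v huv => ?_⟩
    · refine connected_induce_of_center (c := b.1) (.inl rfl) ?_
      rintro a (rfl | ha)
      · exact .refl
      · refine .single ⟨.inl rfl, .inr ha, ?_⟩
        rw [← ha.2]
        exact (hg a ha.1).2.2.1.symm
    · have hnot : ∀ x ∈ B, x ∉ X := fun x hx hx' => Finset.disjoint_left.1 hAB (hXA hx') hx
      refine Set.disjoint_left.2 ?_
      rintro x (rfl | hx) (hx' | hx')
      · exact hne (Subtype.ext hx')
      · exact hnot _ b.2 hx'.1
      · exact hnot _ (hx' ▸ b'.2) hx.1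
      · exact hne (Subtype.ext (hx.2.symm.trans hx'.2))
    · rcases huv with huv | ⟨a, ha, h | h⟩
      · exact ⟨u, .inl rfl, v, .inl rfl, huv⟩
      · refine ⟨a, .inr ⟨ha, by rw [h]⟩, v, .inl rfl, ?_⟩
        have := (hg a ha).2.2.2.1
        rwa [h] at this
      · refine ⟨u, .inl rfl, a, .inr ⟨ha, by rw [h]⟩, ?_⟩
        have := (hg a ha).2.2.2.1
        rw [h] at this
        exact this.symm
  have hQ : ¬ IsMinorOf (completeBipartiteGraph (Fin t) (Fin m)) Q := fun h => hG (h.trans hQG)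
  have hX : X.card ≤ 2 ^ (t + m + 1) * B.card := by
    rcases B.eq_empty_or_nonempty with rfl | hB
    · rcases X.eq_empty_or_nonempty with rfl | ⟨a, ha⟩
      · simp
      · simpa using (hg a ha).1
    have hne : (Finset.univ : Finset B).Nonempty := by
      obtain ⟨b, hb⟩ := hB
      exact ⟨⟨b, hb⟩, Finset.mem_univ _⟩
    have h1 := (degSum_lt_of_not_isMinorOf hQ hne).le
    rw [Finset.card_univ, Fintype.card_coe] at h1
    refine le_trans ?_ h1
    rw [degSum, Finset.sum_coe_sort_eq_attach,
      Finset.card_eq_sum_card_fiberwise (f := fun a => (g a).1) (t := B) fun a ha => (hg a ha).1,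
      ← Finset.sum_attach B]
    refine Finset.sum_le_sum fun b _ => ?_
    rw [degIn, ← Finset.card_map (Function.Embedding.subtype _)]
    refine Finset.card_le_card_of_injOn (fun a => (g a).2) (fun a ha => ?_) ?_
    · obtain ⟨ha, hab⟩ := Finset.mem_filter.1 (Finset.mem_coe.1 ha)
      simp only [Finset.coe_map, Set.mem_image, Finset.mem_coe, Finset.mem_filter,
        Finset.mem_univ, true_and]
      exact ⟨⟨_, (hg a ha).2.1⟩, .inr ⟨a, ha, .inl (Prod.ext hab rfl)⟩, rfl⟩
    · intro a ha a' ha' h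
      obtain ⟨ha, hab⟩ := Finset.mem_filter.1 (Finset.mem_coe.1 ha)
      obtain ⟨ha', hab'⟩ := Finset.mem_filter.1 (Finset.mem_coe.1 ha')
      exact hinj ha ha' (Prod.ext (hab.trans hab'.symm) h)
  have hsub : ∀ a ∈ A, ∃ K ⊆ B.filter (G.Adj a), K.card = t := fun a ha =>
    Finset.exists_subset_card_eq (hA a ha)
  choose! K hK hKt using hsub
  have hrest : (A \ X).card ≤ m * 2 ^ (2 ^ (t + m + 1) + 1) * B.card := by
    have h1 := card_le_of_cliques Q (d := 2 ^ (t + m + 1)) (m := m) ht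
      (fun Y hY => exists_degIn_le_of_not_isMinorOf hQ hY)
      (fun a => (K a).subtype (· ∈ B)) Finset.univ (A \ X) (fun a ha => ?_) fun T J hJ hJT => ?_
    · rwa [Finset.card_univ, Fintype.card_coe] at h1
    · obtain ⟨haA, haX⟩ := Finset.mem_sdiff.1 ha
      have hKB : ∀ x ∈ K a, x ∈ B := fun x hx => (Finset.mem_filter.1 (hK a haA hx)).1
      refine ⟨Finset.subset_univ _, ?_, fun u hu v hv huv => ?_⟩
      · rw [Finset.card_subtype, Finset.filter_true_of_mem hKB, hKt a haA]
      · rw [Finset.mem_subtype] at hu hv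
        by_contra hnot
        have hnew : ∀ a' ∈ X, g a' ≠ (u.1, v.1) := fun a' ha' h => hnot (.inr ⟨a', ha', .inl h⟩)
        have hne : ∀ x ∈ X, x ≠ a := fun x hx h => haX (h ▸ hx)
        have := hmax (insert a X) ⟨Function.update g a (u.1, v.1), ?_, ?_, ?_⟩
        · rw [Finset.card_insert_of_notMem haX] at this
          omega
        · exact Finset.insert_subset haA hXA
        · intro x hx
          rcases Finset.mem_insert.1 hx with rfl | hx
          · rw [Function.update_self]
            exact ⟨u.2, v.2, (Finset.mem_filter.1 (hK x haA hu)).2,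
              (Finset.mem_filter.1 (hK x haA hv)).2, fun h => huv (Subtype.ext h)⟩
          · rw [Function.update_of_ne (hne x hx)]
            exact hg x hx
        · intro x hx y hy hxy
          rw [Finset.mem_coe] at hx hy
          rcases Finset.mem_insert.1 hx with hxa | hx <;>
            rcases Finset.mem_insert.1 hy with hya | hy
          · rw [hxa, hya]
          · rw [hxa, Function.update_self, Function.update_of_ne (hne y hy)] at hxy
            exact (hnew y hy hxy.symm).elim
          · rw [hya, Function.update_self, Function.update_of_ne (hne x hx)] at hxy
            exact (hnew x hx hxy).elim
          · rw [Function.update_of_ne (hne x hx), Function.update_of_ne (hne y hy)] at hxy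
            exact hinj hx hy hxy
    · by_contra hlt
      obtain ⟨I, hI, hIm⟩ := Finset.exists_subset_card_eq (not_le.1 hlt).le
      have hJA : ∀ a ∈ J, a ∈ A := fun a ha => (Finset.mem_sdiff.1 (hJ ha)).1
      obtain ⟨a, ha⟩ : J.Nonempty := by
        rw [← Finset.card_pos]; omega
      have haA := hJA a ha
      refine hG (isMinorOf_of_forall_adj (hKt a haA) hIm fun u hu v hv => ?_)
      have huB := (Finset.mem_filter.1 (hK a haA hu)).1
      have h2 : (⟨u, huB⟩ : B) ∈ (K a).subtype (· ∈ B) := Finset.mem_subtype.2 hu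
      rw [hJT a ha, ← hJT v (hI hv), Finset.mem_subtype] at h2
      exact (Finset.mem_filter.1 (hK v (hJA v (hI hv)) h2)).2.symm
  rw [add_mul, ← Finset.card_sdiff_add_card_eq_card hXA]
  omega

open Classical in
theorem exists_light {t m : ℕ} (ht : 1 ≤ t) : ∃ D : ℕ, ∀ {V : Type*} [Fintype V]
    {G : SimpleGraph V}, ¬ IsMinorOf (completeBipartiteGraph (Fin t) (Fin m)) G → G ≠ ⊥ →
    (∃ v, 1 ≤ degIn G Finset.univ v ∧ degIn G Finset.univ v < t) ∨
      ∃ u v, G.Adj u v ∧ degIn G Finset.univ u ≤ D ∧ degIn G Finset.univ v ≤ D := by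
  set c := 2 ^ (t + m + 1) + m * 2 ^ (2 ^ (t + m + 1) + 1) with hc
  refine ⟨2 ^ (t + m + 1) * (c + 1), fun {V} _ {G} hG hbot => ?_⟩
  set D := 2 ^ (t + m + 1) * (c + 1) with hD
  by_contra! hcon
  obtain ⟨hlow, hlight⟩ := hcon
  have hpos : ∀ u v, G.Adj u v → 1 ≤ degIn G Finset.univ u := fun u v huv =>
    Finset.card_pos.2 ⟨v, by simpa using huv⟩
  set N := Finset.univ.filter fun v => 1 ≤ degIn G Finset.univ v with hN
  set Sm := N.filter fun v => degIn G Finset.univ v ≤ D with hSm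
  set Bg := N.filter fun v => ¬ degIn G Finset.univ v ≤ D with hBg
  have hne : N.Nonempty := by
    obtain ⟨u, v, huv⟩ := SimpleGraph.ne_bot_iff_exists_adj.1 hbot
    exact ⟨u, by simpa [hN] using hpos u v huv⟩
  have h1 := card_le_of_not_isMinorOf ht hG Sm Bg (Finset.disjoint_filter_filter_not _ _ _)
    fun a ha => by
      obtain ⟨haN, haD⟩ := Finset.mem_filter.1 ha
      refine (hlow a (Finset.mem_filter.1 haN).2).trans (Finset.card_le_card fun u hu => ?_)
      have hau := (Finset.mem_filter.1 hu).2
      simp only [hBg, hN, Finset.mem_filter, Finset.mem_univ, true_and, not_le]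
      exact ⟨⟨hpos u a hau.symm, hlight a u hau haD⟩, hau⟩
  have h2 := degSum_lt_of_not_isMinorOf hG hne
  have h3 : D * Bg.card ≤ degSum G N := by
    rw [degSum, mul_comm, ← smul_eq_mul, ← Finset.sum_const]
    refine (Finset.sum_le_sum fun v hv => ?_).trans
      (Finset.sum_le_sum_of_subset (Finset.filter_subset _ _))
    refine (not_le.1 (Finset.mem_filter.1 hv).2).le.trans (Finset.card_le_card fun u hu => ?_)
    have hvu := (Finset.mem_filter.1 hu).2
    simp only [hN, Finset.mem_filter, Finset.mem_univ, true_and]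
    exact ⟨hpos u v hvu.symm, hvu⟩
  have h4 : Sm.card + Bg.card = N.card := Finset.card_filter_add_card_filter_not _
  have h5 : N.card ≤ (c + 1) * Bg.card := by
    rw [← h4, add_mul, one_mul]
    exact Nat.add_le_add_right h1 _
  have h6 := Nat.mul_le_mul_left (2 ^ (t + m + 1)) h5
  rw [← mul_assoc, ← hD] at h6
  omega

end LightEdge

section ListColoring

open Classical in
theorem exists_bounded_degree_defect {t m : ℕ} (ht : 1 ≤ t) (k : ℕ) :
    ∃ D : ℕ, ∀ {V : Type*} [Fintype V] (G : SimpleGraph V),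
      ¬ IsMinorOf (completeBipartiteGraph (Fin t) (Fin m)) G →
      ∃ F ≤ G, (∀ v, degIn F Finset.univ v ≤ D) ∧
        ∀ L : V → Finset (Fin k), (∀ v, t ≤ (L v).card) →
          ∃ c : V → Fin k, (∀ v, c v ∈ L v) ∧ ∀ u v, G.Adj u v → F.Adj u v ∨ c u ≠ c v := by
  obtain ⟨D, hD⟩ := exists_light (m := m) ht
  refine ⟨D, fun {V} _ G => ?_⟩
  induction G using WellFoundedLT.induction with
  | ind G ih =>
  intro hG
  by_cases hbot : G = ⊥
  · refine ⟨G, le_rfl, fun v => by simp [hbot, degIn], fun L hL => ?_⟩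
    have hne : ∀ v, (L v).Nonempty := fun v => Finset.card_pos.1 (ht.trans (hL v))
    choose c hc using hne
    exact ⟨c, hc, fun u v huv => .inl huv⟩
  rcases hD hG hbot with ⟨v, hv1, hvt⟩ | ⟨a, b, hab, ha, hb⟩
  · let G' : SimpleGraph V :=
      { Adj := fun x y => G.Adj x y ∧ x ≠ v ∧ y ≠ v
        symm := ⟨fun x y h => ⟨h.1.symm, h.2.2, h.2.1⟩⟩
        loopless := ⟨fun x h => h.1.ne rfl⟩ }
    have hle : G' ≤ G := fun x y h => h.1
    have hlt : G' < G := by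
      refine lt_of_le_of_ne hle fun h => ?_
      obtain ⟨u, hu⟩ := Finset.card_pos.1 hv1
      have hvu := (Finset.mem_filter.1 hu).2
      rw [← h] at hvu
      exact hvu.2.1 rfl
    obtain ⟨F, hFG, hFD, hF⟩ := ih G' hlt fun h => hG (h.mono_right hle)
    refine ⟨F, hFG.trans hle, hFD, fun L hL => ?_⟩
    obtain ⟨c, hcL, hc⟩ := hF L hL
    obtain ⟨x, hx⟩ : (L v \ (Finset.univ.filter (G.Adj v)).image c).Nonempty := by
      rw [← Finset.card_pos]
      have h1 := Finset.le_card_sdiff ((Finset.univ.filter (G.Adj v)).image c) (L v)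
      have h2 : ((Finset.univ.filter (G.Adj v)).image c).card < t :=
        Finset.card_image_le.trans_lt hvt
      have := hL v
      omega
    obtain ⟨hxL, hxc⟩ := Finset.mem_sdiff.1 hx
    have hxv : ∀ u, G.Adj v u → c u ≠ x := fun u hu h =>
      hxc (Finset.mem_image.2 ⟨u, by simpa using hu, h⟩)
    refine ⟨Function.update c v x, fun w => ?_, fun u w huw => ?_⟩
    · by_cases hw : w = v
      · subst hw; simpa using hxL
      · simpa [hw] using hcL w
    · by_cases hu : u = v
      · subst hu
        right
        rw [Function.update_self, Function.update_of_ne huw.ne']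
        exact (hxv w huw).symm
      · by_cases hw : w = v
        · subst hw
          right
          rw [Function.update_self, Function.update_of_ne hu]
          exact hxv u huw.symm
        · rw [Function.update_of_ne hu, Function.update_of_ne hw]
          exact hc u w ⟨huw, hu, hw⟩
  · set G' := G.deleteEdges {s(a, b)} with hG'
    have hle : G' ≤ G := SimpleGraph.deleteEdges_le _
    have hlt : G' < G := by
      refine lt_of_le_of_ne hle fun h => ?_
      rw [← h, hG', SimpleGraph.deleteEdges_adj] at hab
      exact hab.2 rfl
    obtain ⟨F, hFG, hFD, hF⟩ := ih G' hlt fun h => hG (h.mono_right hle)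
    have hFle : F ⊔ SimpleGraph.edge a b ≤ G :=
      sup_le (hFG.trans hle) ((SimpleGraph.edge_le_iff G).2 (.inr hab))
    refine ⟨F ⊔ SimpleGraph.edge a b, hFle, fun v => ?_, fun L hL => ?_⟩
    · by_cases hva : v = a
      · exact hva ▸ (degIn_mono_right hFle _ _).trans ha
      by_cases hvb : v = b
      · exact hvb ▸ (degIn_mono_right hFle _ _).trans hb
      refine (Finset.card_le_card fun u hu => ?_).trans (hFD v)
      simp only [Finset.mem_filter, SimpleGraph.sup_adj, SimpleGraph.edge_adj, Finset.mem_univ,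
        true_and] at hu ⊢
      tauto
    · obtain ⟨c, hcL, hc⟩ := hF L hL
      refine ⟨c, hcL, fun u v huv => ?_⟩
      by_cases he : s(u, v) = s(a, b)
      · refine .inl (.inr ?_)
        rw [SimpleGraph.edge_adj]
        refine ⟨?_, huv.ne⟩
        simpa using he
      · rcases hc u v (by simpa [hG', huv] using he) with h | h
        · exact .inl (.inl h)
        · exact .inr h

end ListColoring

section Levels

variable {V : Type*} {G H : SimpleGraph V}

/-- `u` and `v` are at distance at most `r` in `H`. -/
def Near (H : SimpleGraph V) (r : ℕ) (u v : V) : Prop := ∃ p : H.Walk u v, p.length ≤ r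

theorem Near.refl (H : SimpleGraph V) (r : ℕ) (u : V) : Near H r u u := ⟨.nil, Nat.zero_le _⟩

theorem Near.symm {r : ℕ} {u v : V} (h : Near H r u v) : Near H r v u := by
  obtain ⟨p, hp⟩ := h
  exact ⟨p.reverse, by simpa using hp⟩

theorem Near.trans {r s : ℕ} {u v w : V} (h : Near H r u v) (h' : Near H s v w) :
    Near H (r + s) u w := by
  obtain ⟨p, hp⟩ := h
  obtain ⟨q, hq⟩ := h'
  exact ⟨p.append q, by rw [SimpleGraph.Walk.length_append]; omega⟩

theorem Near.mono {r s : ℕ} {u v : V} (hGH : G ≤ H) (hrs : r ≤ s) (h : Near G r u v) :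
    Near H s u v := by
  obtain ⟨p, hp⟩ := h
  exact ⟨p.mapLe hGH, by simpa using hp.trans hrs⟩

theorem Near.reachable {r : ℕ} {u v : V} (h : Near H r u v) : H.Reachable u v := by
  obtain ⟨p, -⟩ := h
  exact p.reachable

theorem SimpleGraph.Adj.near {u v : V} (h : H.Adj u v) : Near H 1 u v := ⟨h.toWalk, by simp⟩

theorem ncard_near_le [Fintype V] {D : ℕ} (hD : ∀ v, degIn H Finset.univ v ≤ D) (r : ℕ) (v : V) :
    {u | Near H r v u}.ncard ≤ (D + 1) ^ r := by
  classical
  induction r generalizing v with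
  | zero =>
    have : {u | Near H 0 v u} ⊆ {v} := by
      rintro u ⟨p, hp⟩
      exact (SimpleGraph.Walk.eq_of_length_eq_zero (Nat.le_zero.1 hp)).symm
    simpa using Set.ncard_le_ncard this
  | succ r ih =>
    have hsub : {u | Near H (r + 1) v u} ⊆
        ⋃ w ∈ insert v (Finset.univ.filter (H.Adj v)), {u | Near H r w u} := by
      rintro u ⟨p, hp⟩
      simp only [Set.mem_iUnion]
      cases p with
      | nil => exact ⟨v, Finset.mem_insert_self _ _, Near.refl _ _ _⟩
      | cons h p =>
        refine ⟨_, Finset.mem_insert_of_mem (by simpa using h), p, ?_⟩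
        simpa using hp
    calc _ ≤ _ := Set.ncard_le_ncard hsub
      _ ≤ ∑ w ∈ insert v (Finset.univ.filter (H.Adj v)), {u | Near H r w u}.ncard :=
          Finset.set_ncard_biUnion_le _ _
      _ ≤ (insert v (Finset.univ.filter (H.Adj v))).card • (D + 1) ^ r :=
          Finset.sum_le_card_nsmul _ _ _ fun w _ => ih w
      _ ≤ (D + 1) ^ (r + 1) := by
          rw [smul_eq_mul, pow_succ, mul_comm]
          gcongr
          refine (Finset.card_insert_le _ _).trans (Nat.succ_le_succ ?_)
          exact hD v

/-- `ℓ` is the distance to a fixed root in every component of `H`. -/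
structure IsLevel (H : SimpleGraph V) (ℓ : V → ℕ) : Prop where
  le_succ : ∀ u v, H.Adj u v → ℓ u ≤ ℓ v + 1
  exists_parent : ∀ v, 0 < ℓ v → ∃ u, H.Adj v u ∧ ℓ u + 1 = ℓ v
  root_unique : ∀ u v, H.Reachable u v → ℓ u = 0 → ℓ v = 0 → u = v

theorem exists_isLevel (H : SimpleGraph V) : ∃ ℓ, IsLevel H ℓ := by
  set root : V → V := fun v => (H.connectedComponentMk v).out with hroot
  have hr : ∀ v, H.Reachable v (root v) := fun v =>
    (SimpleGraph.ConnectedComponent.exact (Quot.out_eq (H.connectedComponentMk v))).symm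
  have hrr : ∀ u v, H.Reachable u v → root u = root v := fun u v h => by
    simp only [hroot]
    rw [SimpleGraph.ConnectedComponent.sound h]
  have hle : ∀ u v, H.Adj u v → H.dist u (root u) ≤ H.dist v (root v) + 1 := by
    intro u v h
    obtain ⟨p, hp⟩ := (hr v).exists_walk_length_eq_dist
    rw [hrr u v h.reachable, ← hp, ← SimpleGraph.Walk.length_cons h p]
    exact SimpleGraph.dist_le _
  refine ⟨fun v => H.dist v (root v), hle, fun v hv => ?_, fun u v huv hu hv => ?_⟩
  · obtain ⟨p, hp⟩ := (hr v).exists_walk_length_eq_dist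
    have hne : v ≠ root v := fun h => by
      rw [← h, SimpleGraph.dist_self] at hv
      exact hv.ne rfl
    obtain ⟨u, h, p, rfl⟩ := SimpleGraph.Walk.exists_eq_cons_of_ne hne p
    refine ⟨u, h, ?_⟩
    have h1 := hle v u h
    have h2 := SimpleGraph.dist_le p
    rw [SimpleGraph.Walk.length_cons] at hp
    rw [← hrr v u h.reachable] at h1 ⊢
    omega
  · rw [(hr u).dist_eq_zero_iff] at hu
    rw [(hr v).dist_eq_zero_iff] at hv
    rw [hu, hv, hrr u v huv]

theorem IsLevel.le_add_of_near {ℓ : V → ℕ} (hℓ : IsLevel H ℓ) {r : ℕ} {u v : V}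
    (h : Near H r u v) : ℓ u ≤ ℓ v + r := by
  obtain ⟨p, hp⟩ := h
  induction p generalizing r with
  | nil => omega
  | cons h p ih =>
    rw [SimpleGraph.Walk.length_cons] at hp
    have h1 := ih le_rfl
    have h2 := hℓ.le_succ _ _ h
    omega

theorem IsLevel.exists_chain {ℓ : V → ℕ} (hℓ : IsLevel H ℓ) (v : V) :
    ∃ g : ℕ → V, g (ℓ v) = v ∧ (∀ k ≤ ℓ v, ℓ (g k) = k) ∧ ∀ k < ℓ v, H.Adj (g k) (g (k + 1)) := by
  induction hn : ℓ v generalizing v with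
  | zero => exact ⟨fun _ => v, rfl, fun k hk => by simp only [hn]; omega, fun k hk => by omega⟩
  | succ n ih =>
    obtain ⟨u, hvu, hu⟩ := hℓ.exists_parent v (by omega)
    obtain ⟨g, hg, hgℓ, hga⟩ := ih u (by omega)
    refine ⟨Function.update g (n + 1) v, by simp, fun k hk => ?_, fun k hk => ?_⟩
    · rcases hk.eq_or_lt with rfl | hk
      · simpa using hn
      · rw [Function.update_of_ne hk.ne]
        exact hgℓ k (by omega)
    · rw [Function.update_of_ne hk.ne]
      rcases (Nat.lt_succ_iff.1 hk).eq_or_lt with rfl | hk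
      · rw [Function.update_self, hg]
        exact hvu.symm
      · rw [Function.update_of_ne (by omega)]
        exact hga k hk

theorem connected_induce_image_Icc {g : ℕ → V} {a b : ℕ} (hab : a ≤ b)
    (hg : ∀ k, a ≤ k → k < b → H.Adj (g k) (g (k + 1))) :
    (H.induce (g '' Set.Icc a b)).Connected := by
  refine connected_induce_of_center (c := g a) ⟨a, ⟨le_rfl, hab⟩, rfl⟩ ?_
  rintro _ ⟨k, ⟨hak, hkb⟩, rfl⟩
  induction k, hak using Nat.le_induction with
  | base => exact .refl
  | succ k hak ih =>
    exact (ih (by omega)).tail ⟨⟨k, ⟨hak, by omega⟩, rfl⟩, ⟨k + 1, ⟨by omega, hkb⟩, rfl⟩,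
      hg k hak (by omega)⟩

theorem near_of_chain {g : ℕ → V} {a b : ℕ} (hab : a ≤ b)
    (hg : ∀ k, a ≤ k → k < b → H.Adj (g k) (g (k + 1))) : Near H (b - a) (g a) (g b) := by
  induction b, hab using Nat.le_induction with
  | base => exact Near.refl _ _ _
  | succ b hab ih =>
    have := (ih fun k h1 h2 => hg k h1 (by omega)).trans (hg b hab (by omega)).near
    rwa [← Nat.sub_add_comm hab] at this

/-- The edges of `H` both of whose ends have level in `[a, a + w)`. -/
def chop (H : SimpleGraph V) (ℓ : V → ℕ) (a w : ℕ) : SimpleGraph V where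
  Adj u v := H.Adj u v ∧ (a ≤ ℓ u ∧ ℓ u < a + w) ∧ (a ≤ ℓ v ∧ ℓ v < a + w)
  symm := ⟨fun _ _ h => ⟨h.1.symm, h.2.2, h.2.1⟩⟩
  loopless := ⟨fun _ h => h.1.ne rfl⟩

theorem chop_le (H : SimpleGraph V) (ℓ : V → ℕ) (a w : ℕ) : chop H ℓ a w ≤ H := fun _ _ h => h.1

theorem level_mem_of_reachable_chop {ℓ : V → ℕ} {a w : ℕ} {u v : V}
    (h : (chop H ℓ a w).Reachable u v) (hne : u ≠ v) : a ≤ ℓ v ∧ ℓ v < a + w := by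
  obtain ⟨p⟩ := h.symm
  cases p with
  | nil => exact (hne rfl).elim
  | cons h p => exact h.2.1

/-- `H` arises from `G` by `s` successive restrictions to at most `W` consecutive levels. -/
def Tower (W : ℕ) : ℕ → SimpleGraph V → SimpleGraph V → Prop
  | 0, G, H => H = G
  | s + 1, G, H => ∃ ℓ a w, IsLevel G ℓ ∧ w ≤ W ∧ Tower W s (chop G ℓ a w) H

theorem Tower.mono {W W' : ℕ} (hW : W ≤ W') {s : ℕ} (h : Tower W s G H) : Tower W' s G H := by
  induction s generalizing G with
  | zero => exact h
  | succ s ih =>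
    obtain ⟨ℓ, a, w, hℓ, hw, h⟩ := h
    exact ⟨ℓ, a, w, hℓ, hw.trans hW, ih h⟩

theorem Tower.chop {W s : ℕ} (h : Tower W s G H) {ℓ : V → ℕ} (hℓ : IsLevel H ℓ) (a : ℕ) {w : ℕ}
    (hw : w ≤ W) : Tower W (s + 1) G (chop H ℓ a w) := by
  induction s generalizing G with
  | zero =>
    cases h
    exact ⟨ℓ, a, w, hℓ, hw, rfl⟩
  | succ s ih =>
    obtain ⟨ℓ', a', w', hℓ', hw', h⟩ := h
    exact ⟨ℓ', a', w', hℓ', hw', ih h⟩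

theorem Tower.le {W s : ℕ} (h : Tower W s G H) : H ≤ G := by
  induction s generalizing G with
  | zero => exact h.le
  | succ s ih =>
    obtain ⟨ℓ, a, w, hℓ, hw, h⟩ := h
    exact (ih h).trans (chop_le _ _ _ _)

end Levels

section Hubs

variable {V : Type*}

/-- A model of `K_{s,m}` whose branch sets `S i` carry vertices `q i` that are near `y i` and
far from all the other branch sets. -/
structure HubModel (H : SimpleGraph V) {s m : ℕ} (r M : ℕ) (y : Fin m → V)
    (T : Fin s → Set V) (S : Fin m → Set V) (q : Fin m → V) : Prop where
  conn_left : ∀ j, (H.induce (T j)).Connected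
  conn_right : ∀ i, (H.induce (S i)).Connected
  disj_left : Pairwise fun j j' => Disjoint (T j) (T j')
  disj_right : Pairwise fun i i' => Disjoint (S i) (S i')
  disj : ∀ i j, Disjoint (S i) (T j)
  adj : ∀ i j, ∃ u ∈ S i, ∃ v ∈ T j, H.Adj u v
  tip_mem : ∀ i, q i ∈ S i
  tip_near : ∀ i, Near H M (q i) (y i)
  ball_left : ∀ i u, Near H r (q i) u → ∀ j, u ∉ T j
  ball_right : ∀ i u, Near H r (q i) u → ∀ i', i' ≠ i → u ∉ S i'

theorem HubModel.reachable_right {H : SimpleGraph V} {s m r M : ℕ} {y : Fin m → V}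
    {T : Fin s → Set V} {S : Fin m → Set V} {q : Fin m → V} (h : HubModel H r M y T S q)
    {i : Fin m} {v : V} (hv : v ∈ S i) : H.Reachable (y i) v :=
  (h.tip_near i).symm.reachable.trans <| by
    have := reflTransGen_stepIn_of_connected (h.conn_right i) (h.tip_mem i) hv
    exact (SimpleGraph.reachable_iff_reflTransGen _ _).2 (this.lift id fun _ _ h => h.2.2)

theorem HubModel.reachable_left {H : SimpleGraph V} {s m r M : ℕ} {y : Fin m → V}
    {T : Fin s → Set V} {S : Fin m → Set V} {q : Fin m → V} (h : HubModel H r M y T S q)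
    (i : Fin m) {j : Fin s} {v : V} (hv : v ∈ T j) : H.Reachable (y i) v := by
  obtain ⟨u, hu, w, hw, huw⟩ := h.adj i j
  have := reflTransGen_stepIn_of_connected (h.conn_left j) hw hv
  exact (h.reachable_right hu).trans (huw.reachable.trans
    ((SimpleGraph.reachable_iff_reflTransGen _ _).2 (this.lift id fun _ _ h => h.2.2)))

theorem exists_hubModel {m : ℕ} (hm : 2 ≤ m) (W s : ℕ) : ∀ r : ℕ, ∃ N M : ℕ,
    ∀ {V : Type*} (H B : SimpleGraph V), Tower W s H B → ∀ y : Fin m → V,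
      (∀ i j, B.Reachable (y i) (y j)) → (∀ i j, i ≠ j → ¬ Near H N (y i) (y j)) →
      ∃ (T : Fin s → Set V) (S : Fin m → Set V) (q : Fin m → V), HubModel H r M y T S q := by
  induction s with
  | zero =>
    refine fun r => ⟨r, 0, fun H B _ y _ hy => ⟨fun j => j.elim0, fun i => {y i}, y, ?_⟩⟩
    have hyne : ∀ i j, i ≠ j → y i ≠ y j := fun i j hij h => by
      have := hy i j hij
      rw [h] at this
      exact this (Near.refl _ _ _)
    exact
      { conn_left := fun j => j.elim0
        conn_right := fun i => connected_induce_singleton _ _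
        disj_left := fun j => j.elim0
        disj_right := fun i j hij => Set.disjoint_singleton.2 (hyne i j hij)
        disj := fun _ j => j.elim0
        adj := fun _ j => j.elim0
        tip_mem := fun _ => rfl
        tip_near := fun _ => Near.refl _ _ _
        ball_left := fun _ _ _ j => j.elim0
        ball_right := fun i u hu i' hi' h => hy i i' hi'.symm (Set.mem_singleton_iff.1 h ▸ hu) }
  | succ s ih =>
    intro r
    obtain ⟨N, M, hNM⟩ := ih W
    set L := 2 * r + 2 with hL
    refine ⟨N + 2 * M + 2 * W + 2 * L, W + L + M, fun {V} H B hB y hyr hyN => ?_⟩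
    obtain ⟨ℓ, a, w, hℓ, hwW, hB⟩ := hB
    set H₁ := chop H ℓ a w with hH₁
    have hle : H₁ ≤ H := chop_le _ _ _ _
    obtain ⟨T, S, q, hT⟩ := hNM H₁ B hB y hyr fun i j hij h =>
      hyN i j hij (h.mono hle (by omega))
    have hyH₁ : ∀ i j, H₁.Reachable (y i) (y j) := fun i j => (hyr i j).mono hB.le
    have hyne : ∀ i j, i ≠ j → y i ≠ y j := fun i j hij h => by
      have := hyN i j hij
      rw [h] at this
      exact this (Near.refl _ _ _)
    have hband : ∀ i v, H₁.Reachable (y i) v → a ≤ ℓ v ∧ ℓ v < a + w := by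
      intro i v hv
      obtain ⟨j, hj⟩ : ∃ j, j ≠ i := by
        have : Nontrivial (Fin m) := Fin.nontrivial_iff_two_le.2 hm
        exact exists_ne i
      by_cases hiv : y i = v
      · exact level_mem_of_reachable_chop ((hyH₁ j i).trans hv) fun h =>
          hyne j i hj (h.trans hiv.symm)
      · exact level_mem_of_reachable_chop hv hiv
    have hS : ∀ i, ∀ v ∈ S i, a ≤ ℓ v ∧ ℓ v < a + w := fun i v hv =>
      hband i v (hT.reachable_right hv)
    obtain ⟨i₀, i₁, hij⟩ : ∃ i j : Fin m, i ≠ j := by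
      have : Nontrivial (Fin m) := Fin.nontrivial_iff_two_le.2 hm
      exact exists_pair_ne _
    have hTb : ∀ j, ∀ v ∈ T j, a ≤ ℓ v ∧ ℓ v < a + w := fun j v hv =>
      hband i₀ v (hT.reachable_left i₀ hv)
    choose g hgq hgℓ hga using fun i => hℓ.exists_chain (q i)
    have hn : ∀ i, a ≤ ℓ (q i) ∧ ℓ (q i) < a + w := fun i => hS i _ (hT.tip_mem i)
    have hq : ∀ i, Near H M (q i) (y i) := fun i => (hT.tip_near i).mono hle le_rfl
    have hfar : ∀ i j, i ≠ j → ¬ Near H (N + 2 * W + 2 * L) (q i) (q j) := fun i j hij h =>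
      hyN i j hij ((((hq i).symm.trans h).trans (hq j)).mono le_rfl (by omega))
    have hgnear : ∀ i k, k ≤ ℓ (q i) → Near H (ℓ (q i) - k) (g i k) (q i) := fun i k hk => by
      have := near_of_chain (H := H) hk fun k' _ h => hga i k' h
      rwa [hgq i] at this
    have hroot : ∀ i j, g i 0 = g j 0 := by
      intro i j
      refine hℓ.root_unique _ _ ?_ (hgℓ i 0 (Nat.zero_le _)) (hgℓ j 0 (Nat.zero_le _))
      exact (hgnear i 0 (Nat.zero_le _)).reachable.trans ((hq i).reachable.trans
        (((hyH₁ i j).mono hle).trans ((hq j).symm.reachable.trans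
          (hgnear j 0 (Nat.zero_le _)).symm.reachable)))
    have haL : L < a := by
      by_contra hLa
      have h1 := hgnear i₀ 0 (Nat.zero_le _)
      have h2 := hgnear i₁ 0 (Nat.zero_le _)
      rw [hroot i₁ i₀] at h2
      have h3 := hn i₀
      have h4 := hn i₁
      exact hfar _ _ hij ((h1.symm.trans h2).mono le_rfl (by omega))
    have hlow : ∀ i k, a - L ≤ k → k ≤ ℓ (q i) → Near H (W + L) (q i) (g i k) :=
      fun i k hk hk' => (hgnear i k hk').symm.mono le_rfl (by have := hn i; omega)
    have hin : ∀ i k, a ≤ k → k ≤ ℓ (q i) → Near H₁ W (q i) (g i k) := by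
      intro i k hk hk'
      have h1 : Near H₁ (ℓ (q i) - k) (g i k) (g i (ℓ (q i))) := by
        refine near_of_chain hk' fun k' h1 h2 => ⟨hga i k' h2, ?_, ?_⟩
        · rw [hgℓ i k' h2.le]
          have := hn i; omega
        · rw [hgℓ i (k' + 1) h2]
          have := hn i; omega
      rw [hgq i] at h1
      exact h1.symm.mono le_rfl (by have := hn i; omega)
    set T₀ : Set V := ⋃ i, g i '' Set.Icc 0 (a - L - 1) with hT₀
    have hT₀ℓ : ∀ v ∈ T₀, ℓ v < a - L := by
      intro v hv
      obtain ⟨i, k, ⟨-, hk⟩, rfl⟩ := Set.mem_iUnion.1 hv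
      have := hn i
      rw [hgℓ i k (by omega)]
      omega
    set C : Fin m → Set V := fun i => g i '' Set.Icc (a - L) (ℓ (q i)) with hC
    have hCℓ : ∀ i, ∀ v ∈ C i, a - L ≤ ℓ v ∧ Near H (W + L) (q i) v ∧
        (a ≤ ℓ v → Near H₁ W (q i) v) := by
      rintro i _ ⟨k, ⟨hk, hk'⟩, rfl⟩
      rw [hgℓ i k hk']
      exact ⟨hk, hlow i k hk hk', fun h => hin i k h hk'⟩
    have hCT : ∀ i j, Disjoint (C i) (T j) := fun i j => Set.disjoint_left.2 fun v hv hv' =>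
      hT.ball_left i v ((hCℓ i v hv).2.2 (hTb j v hv').1) j hv'
    have hCS : ∀ i i', i' ≠ i → Disjoint (C i) (S i') := fun i i' hne =>
      Set.disjoint_left.2 fun v hv hv' =>
        hT.ball_right i v ((hCℓ i v hv).2.2 (hS i' v hv').1) i' hne hv'
    have hCC : ∀ i i', i ≠ i' → Disjoint (C i) (C i') := fun i i' hne =>
      Set.disjoint_left.2 fun v hv hv' => hfar i i' hne
        (((hCℓ i v hv).2.1.trans (hCℓ i' v hv').2.1.symm).mono le_rfl (by omega))
    refine ⟨Fin.cons T₀ T, fun i => S i ∪ C i, fun i => g i (a - r - 1), ?_⟩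
    have htip : ∀ i, Near H (W + r + 1) (g i (a - r - 1)) (q i) := fun i => by
      have := hn i
      exact (hgnear i (a - r - 1) (by omega)).mono le_rfl (by omega)
    have hball : ∀ i u, Near H r (g i (a - r - 1)) u → ℓ u < a ∧ a - L ≤ ℓ u := by
      intro i u hu
      have h1 := hℓ.le_add_of_near hu
      have h2 := hℓ.le_add_of_near hu.symm
      have := hn i
      rw [hgℓ i _ (by omega)] at h1 h2
      omega
    exact
      { conn_left := by
          refine Fin.cases ?_ fun j => connected_induce_mono hle (hT.conn_left j)
          have hc : ∀ i, g i₀ 0 ∈ g i '' Set.Icc 0 (a - L - 1) := fun i =>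
            ⟨0, ⟨le_rfl, Nat.zero_le _⟩, hroot i i₀⟩
          refine connected_induce_of_center (c := g i₀ 0) (Set.mem_iUnion.2 ⟨i₀, hc i₀⟩) ?_
          intro v hv
          obtain ⟨i, hv⟩ := Set.mem_iUnion.1 hv
          refine (reflTransGen_stepIn_of_connected (connected_induce_image_Icc (H := H)
            (Nat.zero_le _) fun k _ hk => hga i k ?_) (hc i) hv).lift id fun _ _ h =>
              h.mono le_rfl (Set.subset_iUnion (fun i => g i '' Set.Icc 0 (a - L - 1)) i)
          have := hn i
          omega
        conn_right := fun i => by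
          have := hn i
          exact connected_induce_union (connected_induce_mono hle (hT.conn_right i))
            (connected_induce_image_Icc (by omega) fun k _ hk => hga i k hk) (hT.tip_mem i)
            ⟨ℓ (q i), ⟨by omega, le_rfl⟩, hgq i⟩ (.inl rfl)
        disj_left := by
          have h : ∀ j, Disjoint T₀ (T j) := fun j => Set.disjoint_left.2 fun v hv hv' => by
            have := hT₀ℓ v hv
            have := hTb j v hv'
            omega
          intro i j
          refine Fin.cases ?_ (fun i => ?_) i <;> refine Fin.cases ?_ (fun j => ?_) j
          · simp
          · intro _; simpa using h j
          · intro _; simpa using (h i).symm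
          · intro hij; simpa using hT.disj_left fun h => hij (by rw [h])
        disj_right := fun i i' hne => by
          simp only [Set.disjoint_union_left, Set.disjoint_union_right]
          exact ⟨⟨hT.disj_right hne, hCS i i' hne.symm⟩, (hCS i' i hne).symm, hCC i i' hne⟩
        disj := fun i => by
          refine Fin.cases (Set.disjoint_left.2 fun v hv hv' => ?_) fun j =>
            Set.disjoint_union_left.2 ⟨hT.disj i j, hCT i j⟩
          have h1 := hT₀ℓ v hv'
          rcases hv with hv | hv
          · have := hS i v hv
            omega
          · have := hCℓ i v hv
            omega
        adj := fun i => by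
          have := hn i
          refine Fin.cases ?_ fun j => ?_
          · refine ⟨g i (a - L), .inr ⟨a - L, ⟨le_rfl, by omega⟩, rfl⟩, g i (a - L - 1),
              Set.mem_iUnion.2 ⟨i, a - L - 1, ⟨Nat.zero_le _, le_rfl⟩, rfl⟩, ?_⟩
            have := hga i (a - L - 1) (by omega)
            rw [show a - L - 1 + 1 = a - L by omega] at this
            exact this.symm
          · obtain ⟨u, hu, v, hv, huv⟩ := hT.adj i j
            exact ⟨u, .inl hu, v, hv, hle huv⟩
        tip_mem := fun i => .inr ⟨a - r - 1, ⟨by omega, by have := hn i; omega⟩, rfl⟩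
        tip_near := fun i => ((htip i).trans (hq i)).mono le_rfl (by omega)
        ball_left := fun i u hu => by
          have h1 := hball i u hu
          refine Fin.cases (fun h => ?_) fun j h => ?_
          · have := hT₀ℓ u h
            omega
          · have := hTb j u h
            omega
        ball_right := fun i u hu i' hne hu' => by
          have h1 := hball i u hu
          rcases hu' with hu' | hu'
          · have := hS i' u hu'
            omega
          · exact hfar i i' hne.symm ((((htip i).symm.trans hu).trans
              (hCℓ i' u hu').2.1.symm).mono le_rfl (by omega)) }

end Hubs

section Clusters

variable {V : Type*}

theorem exists_ncard_reachable_le {t m : ℕ} (hm : 2 ≤ m) (D W : ℕ) : ∃ R : ℕ,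
    ∀ {V : Type*} [Fintype V] (F B : SimpleGraph V), (∀ v, degIn F Finset.univ v ≤ D) →
      ¬ IsMinorOf (completeBipartiteGraph (Fin t) (Fin m)) F → Tower W t F B →
      ∀ v, {u | B.Reachable v u}.ncard ≤ R := by
  obtain ⟨N, M, hNM⟩ := exists_hubModel hm W t 0
  refine ⟨m * (D + 1) ^ N, fun {V} _ F B hD hF hB v => ?_⟩
  classical
  set P : Finset V → Prop := fun Y => (∀ y ∈ Y, B.Reachable v y) ∧
    ∀ y ∈ Y, ∀ z ∈ Y, y ≠ z → ¬ Near F N y z with hP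
  obtain ⟨Y, ⟨hYv, hYN⟩, hmax⟩ : ∃ Y, P Y ∧ ∀ Z, P Z → Z.card ≤ Y.card := by
    obtain ⟨Y, hY, hY'⟩ := Set.exists_max_image {Y | P Y} Finset.card (Set.toFinite _)
      ⟨∅, by simp [hP]⟩
    exact ⟨Y, hY, hY'⟩
  have hYm : Y.card ≤ m := by
    by_contra hlt
    obtain ⟨Z, hZY, hZm⟩ := Finset.exists_subset_card_eq (not_le.1 hlt).le
    let e := (Z.equivFinOfCardEq hZm).symm
    obtain ⟨T, S, q, h⟩ := hNM F B hB (fun i => (e i : V))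
      (fun i j => (hYv _ (hZY (e i).2)).symm.trans (hYv _ (hZY (e j).2)))
      fun i j hij => hYN _ (hZY (e i).2) _ (hZY (e j).2) fun h =>
        hij (e.injective (Subtype.ext h))
    exact hF (isMinorOf_completeBipartiteGraph T S h.conn_left h.conn_right h.disj_left
      h.disj_right h.disj h.adj)
  have hsub : {u | B.Reachable v u} ⊆ ⋃ y ∈ Y, {u | Near F N y u} := by
    intro u hu
    by_contra hnot
    simp only [Set.mem_iUnion, not_exists] at hnot
    have huY : u ∉ Y := fun h => hnot u h (Near.refl _ _ _)
    have := hmax (insert u Y) ⟨?_, ?_⟩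
    · rw [Finset.card_insert_of_notMem huY] at this
      omega
    · intro y hy
      rcases Finset.mem_insert.1 hy with rfl | hy
      · exact hu
      · exact hYv y hy
    · intro y hy z hz hne
      rcases Finset.mem_insert.1 hy with hyu | hy <;> rcases Finset.mem_insert.1 hz with hzu | hz
      · exact (hne (hyu.trans hzu.symm)).elim
      · exact hyu ▸ fun h => hnot z hz h.symm
      · exact hzu ▸ hnot y hy
      · exact hYN y hy z hz hne
  calc _ ≤ _ := Set.ncard_le_ncard hsub
    _ ≤ ∑ y ∈ Y, {u | Near F N y u}.ncard := Finset.set_ncard_biUnion_le _ _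
    _ ≤ Y.card • (D + 1) ^ N := Finset.sum_le_card_nsmul _ _ _ fun y _ => ncard_near_le hD N y
    _ ≤ _ := by
      rw [smul_eq_mul]
      gcongr

/-- A jump inside `X` of length at most `r` in `H`. -/
def Jump (H : SimpleGraph V) (r : ℕ) (X : Set V) (a b : V) : Prop := a ∈ X ∧ b ∈ X ∧ Near H r a b

/-- The vertices that can be reached from `v` by jumps of length at most `r` inside `X`. -/
def cluster (H : SimpleGraph V) (r : ℕ) (X : Set V) (v : V) : Set V :=
  {u | Relation.ReflTransGen (Jump H r X) v u}

variable {H : SimpleGraph V}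

theorem self_mem_cluster (H : SimpleGraph V) (r : ℕ) (X : Set V) (v : V) : v ∈ cluster H r X v :=
  Relation.ReflTransGen.refl

theorem mem_cluster_symm {r : ℕ} {X : Set V} {u v : V} (h : u ∈ cluster H r X v) :
    v ∈ cluster H r X u := by
  induction h with
  | refl => exact .refl
  | tail _ h ih => exact .head ⟨h.2.1, h.1, h.2.2.symm⟩ ih

theorem mem_of_mem_cluster {r : ℕ} {X : Set V} {u v : V} (hv : v ∈ X) (h : u ∈ cluster H r X v) :
    u ∈ X := by
  cases h with
  | refl => exact hv
  | tail _ h => exact h.2.1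

theorem cluster_eq_singleton {r : ℕ} {X : Set V} {v : V} (hv : v ∉ X) :
    cluster H r X v = {v} := by
  refine Set.eq_singleton_iff_unique_mem.2 ⟨self_mem_cluster _ _ _ _, fun u hu => ?_⟩
  rcases Relation.ReflTransGen.cases_head hu with h | ⟨w, h, -⟩
  · exact h.symm
  · exact (hv h.1).elim

theorem near_of_mem_cluster [Finite V] {r Z : ℕ} {X : Set V} {u v : V} (h : u ∈ cluster H r X v)
    (hZ : (cluster H r X v).ncard ≤ Z) : Near H (r * Z) v u := by
  classical
  let J : SimpleGraph V :=
    { Adj := fun a b => a ≠ b ∧ Jump H r X a b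
      symm := ⟨fun a b h => ⟨h.1.symm, h.2.2.1, h.2.1, h.2.2.2.symm⟩⟩
      loopless := ⟨fun a h => h.1 rfl⟩ }
  have hnear : ∀ {a b : V} (p : J.Walk a b), Near H (r * p.length) a b := by
    intro a b p
    induction p with
    | nil => exact Near.refl _ _ _
    | cons h p ih =>
      exact (h.2.2.2.trans ih).mono le_rfl (by rw [SimpleGraph.Walk.length_cons]; linarith)
  have hJ : ∀ w, J.Reachable v w → w ∈ cluster H r X v := fun w hw =>
    ((SimpleGraph.reachable_iff_reflTransGen _ _).1 hw).lift id fun _ _ h => h.2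
  have hvu : J.Reachable v u := by
    clear hZ
    induction h with
    | refl => exact .refl _
    | @tail b c _ h ih =>
      by_cases hbc : b = c
      · exact hbc ▸ ih
      · exact ih.trans (SimpleGraph.Adj.reachable (G := J) ⟨hbc, h⟩)
  obtain ⟨p, hp⟩ := hvu.exists_isPath
  refine (hnear p).mono le_rfl (Nat.mul_le_mul_left r ?_)
  have h1 : (p.support.toFinset : Set V) ⊆ cluster H r X v := fun w hw => by
    rw [Finset.mem_coe, List.mem_toFinset] at hw
    exact hJ w (p.takeUntil w hw).reachable
  have h2 := Set.ncard_le_ncard h1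
  rw [Set.ncard_coe_finset, List.toFinset_card_of_nodup hp.support_nodup,
    SimpleGraph.Walk.length_support] at h2
  omega

theorem ncard_cluster_union_le [Fintype V] {D r ρ Z R : ℕ} {X Y : Set V}
    (hD : ∀ v, degIn H Finset.univ v ≤ D) (hY : ∀ v, (cluster H r Y v).ncard ≤ Z)
    (hX : ∀ v, (cluster H ρ X v).ncard ≤ R) (hρ : r * (Z + 2) ≤ ρ) (v : V) :
    (cluster H r (Y ∪ X) v).ncard ≤ Z + R * (1 + (D + 1) ^ r * Z) := by
  classical
  by_cases hv : ∃ x ∈ X, x ∈ cluster H r (Y ∪ X) v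
  · obtain ⟨x₀, hx₀, hx₀v⟩ := hv
    have key : ∀ u ∈ cluster H r (Y ∪ X) x₀, ∃ x ∈ X, x ∈ cluster H ρ X x₀ ∧
        (u = x ∨ ∃ y ∈ Y, Near H r x y ∧ u ∈ cluster H r Y y) := by
      intro u hu
      induction hu with
      | refl => exact ⟨x₀, hx₀, self_mem_cluster _ _ _ _, .inl rfl⟩
      | @tail b c _ h ih =>
        obtain ⟨x, hxX, hx, hbx⟩ := ih
        obtain ⟨-, hc, hbc⟩ := h
        rcases hbx with rfl | ⟨y, hyY, hxy, hby⟩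
        · rcases hc with hc | hc
          · exact ⟨b, hxX, hx, .inr ⟨c, hc, hbc, self_mem_cluster _ _ _ _⟩⟩
          · exact ⟨c, hc, hx.tail ⟨hxX, hc, hbc.mono le_rfl (by nlinarith)⟩, .inl rfl⟩
        · rcases hc with hc | hc
          · exact ⟨x, hxX, hx, .inr ⟨y, hyY, hxy, hby.tail ⟨mem_of_mem_cluster hyY hby, hc, hbc⟩⟩⟩
          · have hxc := (hxy.trans (near_of_mem_cluster hby (hY y))).trans hbc
            exact ⟨c, hc, hx.tail ⟨hxX, hc, hxc.mono le_rfl (by linarith)⟩, .inl rfl⟩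
    have hsub : cluster H r (Y ∪ X) v ⊆ ⋃ x ∈ (cluster H ρ X x₀).toFinset,
        ({x} ∪ ⋃ y ∈ {y | Near H r x y}.toFinset, cluster H r Y y) := by
      intro u hu
      obtain ⟨x, -, hx, hux⟩ := key u ((mem_cluster_symm hx₀v).trans hu)
      simp only [Set.mem_iUnion]
      refine ⟨x, Set.mem_toFinset.2 hx, ?_⟩
      rcases hux with rfl | ⟨y, -, hxy, huy⟩
      · exact .inl rfl
      · exact .inr (Set.mem_biUnion (Set.mem_toFinset.2 hxy) huy)
    have hone : ∀ x, ({x} ∪ ⋃ y ∈ {y | Near H r x y}.toFinset, cluster H r Y y : Set V).ncard ≤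
        1 + (D + 1) ^ r * Z := by
      intro x
      refine (Set.ncard_union_le _ _).trans (Nat.add_le_add (Set.ncard_singleton x).le ?_)
      calc _ ≤ ∑ y ∈ {y | Near H r x y}.toFinset, (cluster H r Y y).ncard :=
            Finset.set_ncard_biUnion_le _ _
        _ ≤ _ := Finset.sum_le_card_nsmul _ _ _ fun y _ => hY y
        _ ≤ (D + 1) ^ r * Z := by
          rw [smul_eq_mul, ← Set.ncard_eq_toFinset_card']
          gcongr
          exact ncard_near_le hD r x
    calc _ ≤ _ := Set.ncard_le_ncard hsub
      _ ≤ _ := Finset.set_ncard_biUnion_le _ _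
      _ ≤ _ := Finset.sum_le_card_nsmul _ _ _ fun x _ => hone x
      _ ≤ R * (1 + (D + 1) ^ r * Z) := by
        rw [smul_eq_mul, ← Set.ncard_eq_toFinset_card']
        gcongr
        exact hX x₀
      _ ≤ _ := Nat.le_add_left _ _
  · push Not at hv
    have hsub : cluster H r (Y ∪ X) v ⊆ cluster H r Y v := by
      intro u hu
      induction hu with
      | refl => exact .refl
      | @tail b c hb h ih =>
        exact ih.tail ⟨h.1.resolve_right fun h => hv b h hb,
          h.2.1.resolve_right fun hc => hv c hc (hb.tail h), h.2.2⟩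
    exact ((Set.ncard_le_ncard hsub).trans (hY v)).trans (Nat.le_add_right _ _)

end Clusters

section Covers

variable {V : Type*}

open Classical in
/-- A cover of the vertices by `k` sets, each vertex being in at least `q` of them, all of whose
clusters at scale `r` have at most `R` elements. -/
def HasCover (H : SimpleGraph V) (k q r R : ℕ) : Prop :=
  ∃ U : Fin k → Set V, (∀ v, q ≤ (Finset.univ.filter fun j => v ∈ U j).card) ∧
    ∀ j v, (cluster H r (U j) v).ncard ≤ R

theorem near_chop {H : SimpleGraph V} {ℓ : V → ℕ} (hℓ : IsLevel H ℓ) {b w ρ : ℕ} {u v : V}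
    (h : Near H ρ u v) (hu : b ≤ ℓ u ∧ ℓ u < b + w) :
    Near (chop H ℓ (b - ρ) (w + 2 * ρ)) ρ u v := by
  obtain ⟨p, hp⟩ := h
  have key : ∀ {a c : V} (p : H.Walk a c),
      (∀ x ∈ p.support, b - ρ ≤ ℓ x ∧ ℓ x < b - ρ + (w + 2 * ρ)) →
      ∃ p' : (chop H ℓ (b - ρ) (w + 2 * ρ)).Walk a c, p'.length = p.length := by
    intro a c p hp
    induction p with
    | nil => exact ⟨.nil, rfl⟩
    | cons h p ih =>
      simp only [SimpleGraph.Walk.support_cons, List.mem_cons, forall_eq_or_imp] at hp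
      obtain ⟨p', hp'⟩ := ih hp.2
      exact ⟨.cons ⟨h, hp.1, hp.2 _ p.start_mem_support⟩ p', congrArg (· + 1) hp'⟩
  classical
  obtain ⟨p', hp'⟩ := key p fun x hx => by
    have hux : Near H ρ u x := ⟨p.takeUntil x hx, (p.length_takeUntil_le_length hx).trans hp⟩
    have h1 := hℓ.le_add_of_near hux
    have h2 := hℓ.le_add_of_near hux.symm
    omega
  exact ⟨p', hp'.trans_le hp⟩

theorem div_eq_div_of_mod_ne {k j b c : ℕ} (hj : j < k) (hb : b % k ≠ j) (hc : c % k ≠ j)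
    (hbc : b ≤ c + 1) (hcb : c ≤ b + 1) : (b + (k - j)) / k = (c + (k - j)) / k := by
  have key : ∀ b, (b + 1) % k ≠ j → (b + (k - j)) / k = (b + 1 + (k - j)) / k := by
    intro b hb
    rw [show b + 1 + (k - j) = b + (k - j) + 1 by ring, Nat.succ_div, if_neg, add_zero]
    rintro ⟨n, hn⟩
    apply hb
    rcases n with _ | n
    · omega
    · rw [show b + 1 = j + k * n by rw [mul_add] at hn; omega, Nat.add_mul_mod_self_left,
        Nat.mod_eq_of_lt hj]
  rcases Nat.lt_trichotomy b c with h | rfl | h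
  · obtain rfl : c = b + 1 := by omega
    exact key b hc
  · rfl
  · obtain rfl : b = c + 1 := by omega
    exact (key c hb).symm

theorem eq_of_div_eq_of_mod_eq {k s b c : ℕ} (h : (b + s) / k = (c + s) / k)
    (h' : b % k = c % k) : b = c := by
  have h1 : (b + s) % k = (c + s) % k := Nat.ModEq.add_right s h'
  have h2 := Nat.div_add_mod (b + s) k
  rw [h, h1, Nat.div_add_mod] at h2
  omega

theorem exists_hasCover_of_chop (D k q r : ℕ) (Rf : ℕ → ℕ → ℕ) : ∃ R : ℕ,
    ∀ {V : Type*} [Fintype V] (H : SimpleGraph V) (ℓ : V → ℕ), IsLevel H ℓ →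
      (∀ v, degIn H Finset.univ v ≤ D) →
      (∀ a w ρ, HasCover (chop H ℓ a w) k (q + 1) ρ (Rf w ρ)) → HasCover H k q r R := by
  let Z : ℕ → ℕ := Nat.rec 1 fun _ Z => Z +
    Rf (r + 1 + 2 * (r * (Z + 2))) (r * (Z + 2)) * (1 + (D + 1) ^ r * Z)
  refine ⟨Z k, fun {V} _ H ℓ hℓ hD hcov => ?_⟩
  classical
  let ρ : ℕ → ℕ := fun e => r * (Z e + 2)
  have hZ : ∀ e, Z (e + 1) = Z e + Rf (r + 1 + 2 * ρ e) (ρ e) * (1 + (D + 1) ^ r * Z e) :=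
    fun e => rfl
  let band : V → ℕ := fun v => ℓ v / (r + 1)
  choose U hUq hUR using fun i : ℕ =>
    hcov (i * (r + 1) - ρ (i % k)) (r + 1 + 2 * ρ (i % k)) (ρ (i % k))
  let U' : Fin k → Set V := fun j => {v | v ∈ U (band v) j ∧ band v % k ≠ j}
  refine ⟨U', fun v => ?_, fun j v => ?_⟩
  · have h1 := hUq (band v) v
    have h2 : ((Finset.univ.filter fun j => v ∈ U (band v) j).filter
        fun j : Fin k => ¬ band v % k = j).card ≤ (Finset.univ.filter fun j => v ∈ U' j).card :=
      Finset.card_le_card fun j hj => by simpa [U'] using hj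
    have h3 : ((Finset.univ.filter fun j => v ∈ U (band v) j).filter
        fun j : Fin k => band v % k = j).card ≤ 1 := Finset.card_le_one.2 fun a ha b hb => by
      rw [Finset.mem_filter] at ha hb
      exact Fin.ext (ha.2.symm.trans hb.2)
    have h4 := Finset.card_filter_add_card_filter_not
      (s := Finset.univ.filter fun j => v ∈ U (band v) j) fun j : Fin k => band v % k = j
    have h5 : q ≤ (Finset.univ.filter fun j => v ∈ U' j).card := by omega
    convert h5
  · let win : V → ℕ := fun v => (band v + (k - j)) / k
    let Y : ℕ → Set V := fun e => {u | u ∈ U' j ∧ win u = win v ∧ band u % k < e}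
    let X : ℕ → Set V := fun e => {u | u ∈ U' j ∧ win u = win v ∧ band u % k = e}
    have hX : ∀ e x, (cluster H (ρ e) (X e) x).ncard ≤ Rf (r + 1 + 2 * ρ e) (ρ e) := by
      intro e x
      by_cases hx : x ∈ X e
      · have hband : ∀ u ∈ X e, band u = band x := fun u hu =>
          eq_of_div_eq_of_mod_eq (hu.2.1.trans hx.2.1.symm) (hu.2.2.trans hx.2.2.symm)
        have h1 := hUR (band x) j x
        rw [hx.2.2] at h1
        refine (Set.ncard_le_ncard fun u hu => ?_).trans h1
        refine hu.lift id fun a b h => ?_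
        have ha := hband a h.1
        have hb := hband b h.2.1
        refine ⟨ha ▸ h.1.1.1, hb ▸ h.2.1.1.1, near_chop hℓ h.2.2 ?_⟩
        rw [id, ← ha]
        have h2 := Nat.div_add_mod (ℓ a) (r + 1)
        have h3 : ℓ a % (r + 1) < r + 1 := Nat.mod_lt _ (Nat.succ_pos r)
        rw [mul_comm] at h2
        simp only [band]
        omega
      · rw [cluster_eq_singleton hx]
        obtain ⟨U₀, -, hU₀⟩ := hcov 0 (r + 1 + 2 * ρ e) (ρ e)
        refine (Set.ncard_le_ncard ?_).trans (hU₀ j x)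
        exact Set.singleton_subset_iff.2 (self_mem_cluster _ _ _ _)
    have hY : ∀ e x, (cluster H r (Y e) x).ncard ≤ Z e := by
      intro e
      induction e with
      | zero =>
        intro x
        rw [cluster_eq_singleton fun hx => Nat.not_lt_zero _ hx.2.2, Set.ncard_singleton]
        exact le_refl 1
      | succ e ih =>
        intro x
        have h1 : Y (e + 1) = Y e ∪ X e := by
          ext u
          simp only [Y, X, Set.mem_ofPred_eq, Set.mem_union, Nat.lt_succ_iff_lt_or_eq]
          tauto
        rw [h1, hZ]
        exact ncard_cluster_union_le hD ih (hX e) le_rfl x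
    refine (Set.ncard_le_ncard fun u hu => ?_).trans (hY k v)
    have key : u ∈ cluster H r (Y k) v ∧ win u = win v := by
      induction hu with
      | refl => exact ⟨self_mem_cluster _ _ _ _, rfl⟩
      | @tail b c _ h ih =>
        have h1 := hℓ.le_add_of_near h.2.2
        have h2 := hℓ.le_add_of_near h.2.2.symm
        have h3 : band b ≤ band c + 1 := by
          rw [← Nat.add_div_right _ (Nat.succ_pos r)]
          exact Nat.div_le_div_right (by omega)
        have h4 : band c ≤ band b + 1 := by
          rw [← Nat.add_div_right _ (Nat.succ_pos r)]
          exact Nat.div_le_div_right (by omega)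
        have h5 : win b = win c := div_eq_div_of_mod_ne j.2 h.1.2 h.2.1.2 h3 h4
        have hk : 0 < k := j.pos
        refine ⟨ih.1.tail ⟨⟨h.1, ih.2, Nat.mod_lt _ hk⟩,
          ⟨h.2.1, h5 ▸ ih.2, Nat.mod_lt _ hk⟩, h.2.2⟩, h5 ▸ ih.2⟩
    exact key.1

theorem exists_hasCover {t m : ℕ} (hm : 2 ≤ m) (D k s : ℕ) (hs : s ≤ t) : ∀ W r : ℕ, ∃ R : ℕ,
    ∀ {V : Type*} [Fintype V] (F H : SimpleGraph V), (∀ v, degIn F Finset.univ v ≤ D) →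
      ¬ IsMinorOf (completeBipartiteGraph (Fin t) (Fin m)) F → Tower W (t - s) F H →
      HasCover H k (k - s) r R := by
  induction s with
  | zero =>
    intro W r
    obtain ⟨R, hR⟩ := exists_ncard_reachable_le (t := t) hm D W
    refine ⟨R, fun F H hD hF hH => ⟨fun _ => Set.univ, fun v => by simp, fun j v => ?_⟩⟩
    refine (Set.ncard_le_ncard fun u hu => ?_).trans (hR F H hD hF hH v)
    induction hu with
    | refl => exact .refl _
    | tail _ h ih => exact ih.trans h.2.2.reachable
  | succ s ih =>
    intro W r
    choose Rf hRf using fun w ρ => ih (by omega) (max W w) ρ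
    by_cases hsk : k ≤ s
    · refine ⟨1, fun F H _ _ _ => ⟨fun _ => ∅, fun v => by omega, fun j v => ?_⟩⟩
      rw [cluster_eq_singleton (Set.notMem_empty v), Set.ncard_singleton]
    obtain ⟨R, hR⟩ := exists_hasCover_of_chop D k (k - (s + 1)) r Rf
    refine ⟨R, fun F H hD hF hH => ?_⟩
    obtain ⟨ℓ, hℓ⟩ := exists_isLevel H
    refine hR H ℓ hℓ (fun v => (degIn_mono_right hH.le _ v).trans (hD v)) fun a w ρ => ?_
    have h1 := (hH.mono (le_max_left W w)).chop hℓ a (le_max_right W w)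
    rw [show t - (s + 1) + 1 = t - s by omega] at h1
    have h2 := hRf w ρ F _ hD hF h1
    rwa [show k - s = k - (s + 1) + 1 by omega] at h2

end Covers

theorem memClass_of_isMinorOf {𝒢 : ∀ n : ℕ, SimpleGraph (Fin n) → Prop} (hmc : MinorClosed 𝒢)
    {W : Type*} [Fintype W] {H : SimpleGraph W} {n : ℕ} {G : SimpleGraph (Fin n)} (hG : 𝒢 n G)
    (h : IsMinorOf H G) : MemClass 𝒢 H := by
  let e := Fintype.equivFin W
  refine ⟨Fintype.card W, H.map e.toEmbedding, hmc.2 G _ hG (IsMinorOf.trans ?_ h),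
    ⟨SimpleGraph.Iso.map e H⟩⟩
  refine isMinorOf_of_injective e.symm e.symm.injective fun a b hab => ?_
  obtain ⟨-, x, y, hxy, rfl, rfl⟩ := hab
  simpa using hxy

/-- if `𝒢` is minor-closed and for some `t, m ≥ 1` neither `K_{t,m}` nor
`I_{t-1}+P_m` belongs to `𝒢`, then there is `C ≥ 1` such that every graph in `𝒢` admits a
`2t`-coloring with clustering `C`. -/
theorem stmt6 (𝒢 : ∀ n : ℕ, SimpleGraph (Fin n) → Prop) (hmc : MinorClosed 𝒢)
    (t m : ℕ) (ht : 1 ≤ t) (hm : 1 ≤ m)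
    (hK : ¬ MemClass 𝒢 (completeBipartiteGraph (Fin t) (Fin m)))
    (hI : ¬ MemClass 𝒢 (IplusP (t-1) m)) :
    ∃ C : ℕ, 1 ≤ C ∧ ∀ (n : ℕ) (G : SimpleGraph (Fin n)), 𝒢 n G →
      ∃ c : Fin n → Fin (2*t), ClusteredColoring G C c := by
  classical
  obtain ⟨D, hD⟩ := exists_bounded_degree_defect (m := m + 1) ht (2 * t)
  obtain ⟨R, hR⟩ := exists_hasCover (t := t) (m := m + 1) (by omega) D (2 * t) t le_rfl 0 1
  refine ⟨max R 1, le_max_right _ _, fun n G hG => ?_⟩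
  have hminor : ¬ IsMinorOf (completeBipartiteGraph (Fin t) (Fin (m + 1))) G := by
    intro h
    refine hK (memClass_of_isMinorOf hmc hG (IsMinorOf.trans ?_ h))
    refine isMinorOf_of_injective (Sum.map id Fin.castSucc)
      (Function.injective_id.sumMap (Fin.castSucc_injective m)) ?_
    rintro (a | a) (b | b) hab <;> simp at hab ⊢
  obtain ⟨F, hFG, hFD, hF⟩ := hD G hminor
  obtain ⟨U, hUt, hUR⟩ := hR F F hFD (fun h => hminor (h.mono_right hFG))
    (by rw [Nat.sub_self]; rfl)
  obtain ⟨c, hcU, hc⟩ := hF (fun v => Finset.univ.filter fun j => v ∈ U j) fun v => by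
    have := hUt v
    rwa [show 2 * t - t = t by omega] at this
  have hcU : ∀ v, v ∈ U (c v) := fun v => (Finset.mem_filter.1 (hcU v)).2
  refine ⟨c, fun S hS hmono => ?_⟩
  obtain ⟨v, hv⟩ := Set.nonempty_coe_sort.1 hS.nonempty
  have hsub : S ⊆ cluster F 1 (U (c v)) v := fun u hu => by
    refine (reflTransGen_stepIn_of_connected hS hv hu).lift id fun a b h => ?_
    refine ⟨hmono a h.1 v hv ▸ hcU a, hmono b h.2.1 v hv ▸ hcU b, ?_⟩
    exact ((hc a b h.2.2).resolve_right fun hne => hne (hmono a h.1 b h.2.1)).near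
  exact ((Set.ncard_le_ncard hsub).trans (hUR _ v)).trans (le_max_left _ _)
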